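/- Assume G is a good normal subgroup of W~ and that G contains no reflection of V~. Then: (i) G is generated by double reflections, i.e. by elements g of G such that ker(g - 1) has codimension 2 in V~; (ii) the image in W ⊆ GL(V) of any reflection of W~ is a reflection of V of the same order; (iii) G is contained in SL(V~), i.e. every element of G has determinant 1. -/

import Mathlib

open MvPolynomial

noncomputable section

namespace ReflQuot

variable {k : Type} [Field k]

/-- The action of an invertible matrix `g` on polynomial functions on `k^n`:
the linear form `X i` is sent to `∑ j, (g⁻¹) i j • X j`, so that
`(g • f) (v) = f (g⁻¹ ⬝ v)`. -/
def matAct {n : ℕ} (g : Matrix.GeneralLinearGroup (Fin n) k) :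
    MvPolynomial (Fin n) k →ₐ[k] MvPolynomial (Fin n) k :=
  aeval fun i => ∑ j, ((↑(g⁻¹) : Matrix (Fin n) (Fin n) k) i j) • X j

/-- The algebra endomorphism of `k[X_1,…,X_m]` sending `X i` to `∑ j, M i j • X j`. -/
def polyAct {m : ℕ} (M : Fin m → Fin m → k) :
    MvPolynomial (Fin m) k →ₐ[k] MvPolynomial (Fin m) k :=
  aeval fun i => ∑ j, M i j • X j

/-- A reflection: an automorphism of finite order whose fixed-point subspace is a
hyperplane. -/
def IsReflection {n : ℕ} (M : Matrix (Fin n) (Fin n) k) : Prop :=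
  IsOfFinOrder M ∧
    Module.finrank k (LinearMap.ker (Matrix.toLin' M - LinearMap.id)) + 1 = n

/-- A double reflection: finite order, fixed points of codimension 2. -/
def IsDoubleReflection {n : ℕ} (M : Matrix (Fin n) (Fin n) k) : Prop :=
  IsOfFinOrder M ∧
    Module.finrank k (LinearMap.ker (Matrix.toLin' M - LinearMap.id)) + 2 = n

/-- A reflection group: a group generated by its reflections. -/
def IsReflectionGroup {n : ℕ} (W : Subgroup (Matrix.GeneralLinearGroup (Fin n) k)) : Prop :=
  Subgroup.closure {g | g ∈ W ∧ IsReflection ((g : Matrix (Fin n) (Fin n) k))} = W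

/-- The algebra of `G`-invariant polynomials. -/
def invariants {n : ℕ} (G : Subgroup (Matrix.GeneralLinearGroup (Fin n) k)) :
    Subalgebra k (MvPolynomial (Fin n) k) where
  carrier := {f | ∀ g ∈ G, matAct g f = f}
  mul_mem' := fun {a b} ha hb g hg => by
    rw [map_mul, ha g hg, hb g hg]
  one_mem' := fun g _ => map_one (matAct g)
  add_mem' := fun {a b} ha hb g hg => by
    rw [map_add, ha g hg, hb g hg]
  zero_mem' := fun g _ => map_zero (matAct g)
  algebraMap_mem' := fun r g _ => (matAct g).commutes r

/-- The linear span of products of two positive-degree invariants, i.e. `(B^G_+)^2`. -/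
def sqSpan {n : ℕ} (G : Subgroup (Matrix.GeneralLinearGroup (Fin n) k)) :
    Submodule k (MvPolynomial (Fin n) k) :=
  Submodule.span k {f | ∃ u ∈ invariants G, ∃ v ∈ invariants G,
    constantCoeff u = 0 ∧ constantCoeff v = 0 ∧ f = u * v}

/-- The ideal of positive-degree elements of the polynomial ring. -/
def idealPlus (k : Type) [Field k] (m : ℕ) : Ideal (MvPolynomial (Fin m) k) :=
  Ideal.span (Set.range X)

/-- The ideal `I` of relations between the generators `p i` of the invariant algebra:
the kernel of `k[V] = k[X_1,…,X_m] → B^G`, `X i ↦ p i`. -/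
def relIdeal {n m : ℕ} (p : Fin m → MvPolynomial (Fin n) k) :
    Ideal (MvPolynomial (Fin m) k) :=
  RingHom.ker (aeval p : MvPolynomial (Fin m) k →ₐ[k] MvPolynomial (Fin n) k)

/-- The context: `Wt` is a finite reflection group on `k^n`, `G` a normal subgroup of `Wt`,
`p` a minimal system of homogeneous generators (of degrees `d`) of the invariant algebra
`B^G` whose span is `Wt`-stable (i.e. a graded `W`-equivariant section of
`B^G_+ → B^G_+/(B^G_+)^2`), and `c w` the matrix of the action of `w` on the span of the
`p i`, giving the induced action of `W = Wt/G` on `V = k^m`. -/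
structure QuotSetup {n m : ℕ} (Wt G : Subgroup (Matrix.GeneralLinearGroup (Fin n) k))
    (p : Fin m → MvPolynomial (Fin n) k) (d : Fin m → ℕ)
    (c : ↥Wt → Fin m → Fin m → k) : Prop where
  finite : (Wt : Set (Matrix.GeneralLinearGroup (Fin n) k)).Finite
  reflGroup : IsReflectionGroup Wt
  le : G ≤ Wt
  normal : ∀ w ∈ Wt, ∀ g ∈ G, w * g * w⁻¹ ∈ G
  homog : ∀ i, (p i).IsHomogeneous (d i)
  dpos : ∀ i, 0 < d i
  gen : Algebra.adjoin k (Set.range p) = invariants G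
  minimal : ∀ a : Fin m → k, (∑ i, a i • p i) ∈ sqSpan G → a = 0
  equivar : ∀ (w : ↥Wt) (i), matAct (w : Matrix.GeneralLinearGroup (Fin n) k) (p i)
      = ∑ j, c w i j • p j

/-- `W = Wt/G` acts trivially on the conormal module `I/(A_+ I)`. -/
def TrivialConormal {n m : ℕ} (Wt : Subgroup (Matrix.GeneralLinearGroup (Fin n) k))
    (p : Fin m → MvPolynomial (Fin n) k) (c : ↥Wt → Fin m → Fin m → k) : Prop :=
  ∀ w : ↥Wt, ∀ f ∈ relIdeal p, polyAct (c w) f - f ∈ idealPlus k m * relIdeal p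

/-- `G` is of complete intersection: `I` is generated by `dim V - dim Vt = m - n` elements. -/
def IsCompleteIntersection {n m : ℕ} (p : Fin m → MvPolynomial (Fin n) k) : Prop :=
  ∃ s : Finset (MvPolynomial (Fin m) k), s.card = m - n ∧ Ideal.span (s : Set _) = relIdeal p

/-- `G` is a good normal subgroup of `Wt`. -/
def IsGoodQuot {n m : ℕ} (Wt : Subgroup (Matrix.GeneralLinearGroup (Fin n) k))
    (p : Fin m → MvPolynomial (Fin n) k) (c : ↥Wt → Fin m → Fin m → k) : Prop :=
  IsCompleteIntersection p ∧ TrivialConormal Wt p c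


/-- The pointwise stabilizer of a subspace `L` in `GL_n(k)`. -/
def pointStab {n : ℕ} (L : Submodule k (Fin n → k)) :
    Subgroup (Matrix.GeneralLinearGroup (Fin n) k) where
  carrier := {g | ∀ x ∈ L, Matrix.mulVec (g : Matrix (Fin n) (Fin n) k) x = x}
  one_mem' := fun x _ => Matrix.one_mulVec x
  mul_mem' := fun {a b} ha hb x hx => by
    rw [Units.val_mul, ← Matrix.mulVec_mulVec, hb x hx, ha x hx]
  inv_mem' := fun {a} ha x hx => by
    have h1 : Matrix.mulVec (↑(a⁻¹) : Matrix (Fin n) (Fin n) k)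
        (Matrix.mulVec (↑a : Matrix (Fin n) (Fin n) k) x) = x := by
      rw [Matrix.mulVec_mulVec, ← Units.val_mul, inv_mul_cancel, Units.val_one,
        Matrix.one_mulVec]
    rw [ha x hx] at h1
    exact h1

/-- The set of reflecting hyperplanes of a subgroup `W` of `GL_n(k)`. -/
def reflHyps {n : ℕ} (W : Subgroup (Matrix.GeneralLinearGroup (Fin n) k)) :
    Set (Submodule k (Fin n → k)) :=
  {H | ∃ g ∈ W, IsReflection ((g : Matrix (Fin n) (Fin n) k)) ∧
      H = LinearMap.ker (Matrix.toLin' ((g : Matrix (Fin n) (Fin n) k)) - LinearMap.id)}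

/-- The set `A'(Wt)` of reflecting hyperplanes `H` of `Wt` such that `Wt_H ≠ G_H`. -/
def reflHyps' {n : ℕ} (Wt G : Subgroup (Matrix.GeneralLinearGroup (Fin n) k)) :
    Set (Submodule k (Fin n → k)) :=
  {H | H ∈ reflHyps Wt ∧ ¬ (Wt ⊓ pointStab H ≤ G)}

/-- `Wt_H` and `Wt_{H'}` have the same image in `W = Wt/G`. -/
def imageEq {n : ℕ} (Wt G : Subgroup (Matrix.GeneralLinearGroup (Fin n) k))
    (H H' : Submodule k (Fin n → k)) : Prop :=
  {x | ∃ g ∈ G, ∃ u ∈ Wt ⊓ pointStab H, x = g * u}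
    = {x | ∃ g ∈ G, ∃ u ∈ Wt ⊓ pointStab H', x = g * u}

/-- `e_H = |G_H|`. -/
def eH {n : ℕ} (G : Subgroup (Matrix.GeneralLinearGroup (Fin n) k))
    (H : Submodule k (Fin n → k)) : ℕ :=
  Nat.card ↥(G ⊓ pointStab H)

/-- The map `p : Vt → V`, `x ↦ (p 1 (x), …, p m (x))`. -/
def pMap {n m : ℕ} (p : Fin m → MvPolynomial (Fin n) k) (x : Fin n → k) : Fin m → k :=
  fun i => eval x (p i)

/-- The matrix of the action of (the image in `W` of) `w` on `V = k^m`. -/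
def qMat {n m : ℕ} {Wt : Subgroup (Matrix.GeneralLinearGroup (Fin n) k)}
    (c : ↥Wt → Fin m → Fin m → k) (w : ↥Wt) : Matrix (Fin m) (Fin m) k :=
  Matrix.of (c w⁻¹)

/-- The set of reflecting hyperplanes of `W = Wt/G` acting on `V = k^m`. -/
def reflHypsV {n m : ℕ} {Wt : Subgroup (Matrix.GeneralLinearGroup (Fin n) k)}
    (c : ↥Wt → Fin m → Fin m → k) : Set (Submodule k (Fin m → k)) :=
  {K | ∃ w : ↥Wt, IsReflection (qMat c w) ∧
      K = LinearMap.ker (Matrix.toLin' (qMat c w) - LinearMap.id)}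

/-- The underlying matrix of an element of a subgroup of `GL_n(k)`. -/
def matOf {n : ℕ} {Wt : Subgroup (Matrix.GeneralLinearGroup (Fin n) k)} (w : ↥Wt) :
    Matrix (Fin n) (Fin n) k :=
  ((w : Matrix.GeneralLinearGroup (Fin n) k) : Matrix (Fin n) (Fin n) k)

/-! ### The action on polynomial functions -/

theorem matAct_X {n : ℕ} (g : Matrix.GeneralLinearGroup (Fin n) k) (i : Fin n) :
    matAct g (X i) = ∑ j, ((↑(g⁻¹) : Matrix (Fin n) (Fin n) k) i j) • X j := by
  simp [matAct]

theorem eval_matAct {n : ℕ} (g : Matrix.GeneralLinearGroup (Fin n) k) (x : Fin n → k)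
    (f : MvPolynomial (Fin n) k) :
    eval x (matAct g f) = eval (Matrix.mulVec (↑(g⁻¹) : Matrix (Fin n) (Fin n) k) x) f := by
  induction f using MvPolynomial.induction_on with
  | C a => simp [matAct]
  | add p q hp hq => simp [hp, hq]
  | mul_X p i hp =>
    rw [map_mul, map_mul, hp, matAct_X]
    simp [Matrix.mulVec, dotProduct, smul_eval]

theorem matAct_one {n : ℕ} (f : MvPolynomial (Fin n) k) :
    matAct (1 : Matrix.GeneralLinearGroup (Fin n) k) f = f := by
  have : matAct (1 : Matrix.GeneralLinearGroup (Fin n) k) = AlgHom.id k _ := by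
    ext i : 1
    rw [matAct_X]
    simp [Matrix.one_apply]
  rw [this]; rfl

theorem matAct_mul {n : ℕ} (g h : Matrix.GeneralLinearGroup (Fin n) k)
    (f : MvPolynomial (Fin n) k) : matAct (g * h) f = matAct g (matAct h f) := by
  have : matAct (g * h) = (matAct g).comp (matAct h) := by
    ext i : 1
    rw [AlgHom.comp_apply, matAct_X, matAct_X]
    simp only [map_sum, map_smul, matAct_X, mul_inv_rev, Units.val_mul, Matrix.mul_apply,
      Finset.sum_smul, Finset.smul_sum, smul_smul]
    rw [Finset.sum_comm]
  rw [this]; rfl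

theorem isHomogeneous_matAct {n : ℕ} (g : Matrix.GeneralLinearGroup (Fin n) k)
    {f : MvPolynomial (Fin n) k} {e : ℕ} (hf : f.IsHomogeneous e) :
    (matAct g f).IsHomogeneous e := by
  have := MvPolynomial.IsHomogeneous.aeval (φ := f) (n := 1) (m := e) hf
    (fun i => ∑ j, ((↑(g⁻¹) : Matrix (Fin n) (Fin n) k) i j) • (X j : MvPolynomial (Fin n) k))
    (fun i => ?_)
  · rwa [one_mul] at this
  · refine IsHomogeneous.sum _ _ _ fun j _ => ?_
    rw [smul_eq_C_mul]
    simpa using (isHomogeneous_C _ _).mul (isHomogeneous_X k j)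

/-- The projection `∑_{g ∈ G} χ(g)⁻¹ g`, up to a scalar, onto the semi-invariants of
character `χ`. -/
def semi {n : ℕ} {G : Subgroup (Matrix.GeneralLinearGroup (Fin n) k)} [Fintype G]
    (χ : G →* kˣ) : MvPolynomial (Fin n) k →ₗ[k] MvPolynomial (Fin n) k :=
  ∑ g : G, ((χ g)⁻¹ : kˣ).val • (matAct (g : Matrix.GeneralLinearGroup (Fin n) k)).toLinearMap

section Semi

variable {n : ℕ} {G : Subgroup (Matrix.GeneralLinearGroup (Fin n) k)} [Fintype G]

theorem semi_apply (χ : G →* kˣ) (b : MvPolynomial (Fin n) k) :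
    semi χ b =
      ∑ g : G, ((χ g)⁻¹ : kˣ).val • matAct (g : Matrix.GeneralLinearGroup (Fin n) k) b := by
  simp [semi]

theorem matAct_semi (χ : G →* kˣ) (b : MvPolynomial (Fin n) k) (h : G) :
    matAct (h : Matrix.GeneralLinearGroup (Fin n) k) (semi χ b) = (χ h).val • semi χ b := by
  rw [semi_apply, map_sum, Finset.smul_sum]
  refine Fintype.sum_equiv (Equiv.mulLeft h) _ _ fun g => ?_
  rw [map_smul, smul_smul, ← matAct_mul, Equiv.coe_mulLeft, Subgroup.coe_mul]
  congr 1
  rw [← Units.val_mul, map_mul]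
  simp

theorem semi_one_mem (b : MvPolynomial (Fin n) k) :
    semi (1 : G →* kˣ) b ∈ invariants G := fun g hg => by
  simpa using matAct_semi (1 : G →* kˣ) b ⟨g, hg⟩

theorem semi_mul (χ : G →* kˣ) {r : MvPolynomial (Fin n) k} (hr : r ∈ invariants G)
    (b : MvPolynomial (Fin n) k) : semi χ (r * b) = r * semi χ b := by
  rw [semi_apply, semi_apply, Finset.mul_sum]
  refine Finset.sum_congr rfl fun g _ => ?_
  rw [map_mul, hr g g.2, mul_smul_comm]

theorem semi_of_semi (χ : G →* kˣ) {b : MvPolynomial (Fin n) k}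
    (hb : ∀ g : G, matAct (g : Matrix.GeneralLinearGroup (Fin n) k) b = (χ g).val • b) :
    semi χ b = (Fintype.card G : k) • b := by
  rw [semi_apply]
  simp [hb, smul_smul, Nat.cast_smul_eq_nsmul k]

theorem isHomogeneous_semi (χ : G →* kˣ) {f : MvPolynomial (Fin n) k} {e : ℕ}
    (hf : f.IsHomogeneous e) : (semi χ f).IsHomogeneous e := by
  rw [semi_apply]
  refine IsHomogeneous.sum _ _ _ fun g _ => ?_
  rw [smul_eq_C_mul]
  simpa using (isHomogeneous_C _ _).mul (isHomogeneous_matAct g.1 hf)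

theorem eval_semi (χ : G →* kˣ) (x : Fin n → k) (b : MvPolynomial (Fin n) k) :
    eval x (semi χ b) = ∑ g : G, ((χ g)⁻¹ : kˣ).val *
      eval (Matrix.mulVec (↑((g : Matrix.GeneralLinearGroup (Fin n) k)⁻¹) :
        Matrix (Fin n) (Fin n) k) x) b := by
  rw [semi_apply, map_sum]
  simp [smul_eval, eval_matAct]

end Semi

/-! ### Separating points -/

/-- A polynomial equal to `1` at `x` and to `0` on a finite set not containing `x`. -/
theorem exists_eval_separating {n : ℕ} (x : Fin n → k) (S : Finset (Fin n → k)) (hx : x ∉ S) :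
    ∃ q : MvPolynomial (Fin n) k, eval x q = 1 ∧ ∀ y ∈ S, eval y q = 0 := by
  classical
  have h : ∀ y : Fin n → k, ∃ q : MvPolynomial (Fin n) k, y ≠ x → eval x q = 1 ∧ eval y q = 0 := by
    intro y
    by_cases hy : y = x
    · exact ⟨0, fun h => (h hy).elim⟩
    · obtain ⟨i, hi⟩ := Function.ne_iff.mp hy
      refine ⟨C ((x i - y i)⁻¹) * (X i - C (y i)), fun _ => ⟨?_, by simp⟩⟩
      have : x i - y i ≠ 0 := sub_ne_zero.mpr (Ne.symm hi)
      simp [this]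
  choose q hq using h
  refine ⟨∏ y ∈ S, q y, ?_, fun y hy => ?_⟩
  · rw [map_prod]
    exact Finset.prod_eq_one fun y hy => (hq y (fun h => hx (h ▸ hy))).1
  · rw [map_prod]
    exact Finset.prod_eq_zero hy (hq y (fun h => hx (h ▸ hy))).2

theorem mem_invariants_iff {n m : ℕ} {G : Subgroup (Matrix.GeneralLinearGroup (Fin n) k)}
    {p : Fin m → MvPolynomial (Fin n) k} (hgen : Algebra.adjoin k (Set.range p) = invariants G)
    {r : MvPolynomial (Fin n) k} : r ∈ invariants G ↔
      ∃ a : MvPolynomial (Fin m) k, aeval p a = r := by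
  rw [← hgen, Algebra.adjoin_range_eq_range_aeval]
  rfl

/-! ### Directional derivatives -/

/-- The derivative in the direction of the vector `v`. -/
def dirD {σ : Type} (v : σ → k) : Derivation k (MvPolynomial σ k) (MvPolynomial σ k) :=
  mkDerivation k fun i => C (v i)

@[simp] theorem dirD_X {σ : Type} (v : σ → k) (i : σ) : dirD v (X i) = C (v i) := by
  simp [dirD, mkDerivation_X]

@[simp] theorem dirD_C {σ : Type} (v : σ → k) (a : k) : dirD v (C a) = 0 := by
  simp [dirD]

theorem eval_aeval' {σ τ : Type} (p : τ → MvPolynomial σ k) (x : σ → k)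
    (a : MvPolynomial τ k) :
    eval x (aeval p a) = eval (fun i => eval x (p i)) a := by
  induction a using MvPolynomial.induction_on with
  | C a => simp [algebraMap_eq]
  | add p q hp hq => simp only [map_add, hp, hq]
  | mul_X q i hq => simp only [map_mul, hq, aeval_X, eval_X]

theorem eval_dirD_aeval {σ τ : Type} (p : τ → MvPolynomial σ k) (x v : σ → k)
    (a : MvPolynomial τ k) :
    eval x (dirD v (aeval p a)) =
      eval (fun i => eval x (p i)) (dirD (fun i => eval x (dirD v (p i))) a) := by
  induction a using MvPolynomial.induction_on with
  | C a => simp [algebraMap_eq]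
  | add p q hp hq => simp only [map_add, hp, hq]
  | mul_X q i hq =>
    simp only [map_mul, Derivation.leibniz, smul_eq_mul, map_add, hq, aeval_X, dirD_X, eval_C,
      eval_X, eval_aeval']

theorem dirD_add {σ : Type} (v w : σ → k) (f : MvPolynomial σ k) :
    dirD (v + w) f = dirD v f + dirD w f := by
  have : dirD (v + w) = dirD v + dirD w := derivation_ext fun i => by simp
  rw [this]; rfl

theorem dirD_smul {σ : Type} (c : k) (v : σ → k) (f : MvPolynomial σ k) :
    dirD (c • v) f = c • dirD v f := by
  have : dirD (c • v) = c • dirD v := derivation_ext fun i => by simp [smul_eq_C_mul]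
  rw [this]; rfl

/-! ### Differential of the quotient map at a point with trivial stabilizer -/

theorem exists_eq_sum_of_eval {n : ℕ} (x : Fin n → k) (f : MvPolynomial (Fin n) k) :
    ∃ h : Fin n → MvPolynomial (Fin n) k, f = C (eval x f) + ∑ i, (X i - C (x i)) * h i := by
  induction f using MvPolynomial.induction_on with
  | C a => exact ⟨0, by simp⟩
  | add p q hp hq =>
    obtain ⟨h, hh⟩ := hp
    obtain ⟨h', hh'⟩ := hq
    refine ⟨h + h', ?_⟩
    simp only [Pi.add_apply, mul_add, Finset.sum_add_distrib, map_add]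
    linear_combination hh + hh'
  | mul_X p j hp =>
    obtain ⟨h, hh⟩ := hp
    refine ⟨fun i => X j * h i + if i = j then C (eval x p) else 0, ?_⟩
    simp only [mul_add, Finset.sum_add_distrib, mul_ite, mul_zero, Finset.sum_ite_eq',
      Finset.mem_univ, if_true, map_mul, eval_X, mul_left_comm _ (X j : MvPolynomial (Fin n) k),
      ← Finset.mul_sum]
    linear_combination X j * hh

theorem eval_dirD_of_eq_sum {n : ℕ} (x v : Fin n → k) (h : Fin n → MvPolynomial (Fin n) k)
    (a : k) : eval x (dirD v (C a + ∑ i, (X i - C (x i)) * h i)) = ∑ i, v i * eval x (h i) := by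
  simp [mul_comm]

/-- The differential of the map with components `p` at the point `x`. -/
def dp {σ τ : Type} (p : τ → MvPolynomial σ k) (x : σ → k) : (σ → k) →ₗ[k] (τ → k) where
  toFun v i := eval x (dirD v (p i))
  map_add' v w := by ext i; simp [dirD_add]
  map_smul' c v := by ext i; simp [dirD_smul, smul_eval]

theorem eval_dirD_matAct {n : ℕ} (g : Matrix.GeneralLinearGroup (Fin n) k) (x v : Fin n → k)
    (f : MvPolynomial (Fin n) k) :
    eval x (dirD v (matAct g f)) =
      eval (Matrix.mulVec (↑(g⁻¹) : Matrix (Fin n) (Fin n) k) x)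
        (dirD (Matrix.mulVec (↑(g⁻¹) : Matrix (Fin n) (Fin n) k) v) f) := by
  have h1 : (fun i => eval x (∑ j, ((↑(g⁻¹) : Matrix (Fin n) (Fin n) k) i j) • X j)) =
      Matrix.mulVec (↑(g⁻¹) : Matrix (Fin n) (Fin n) k) x := by
    ext i; simp [Matrix.mulVec, dotProduct, smul_eval]
  have h2 : (fun i => eval x (dirD v (∑ j, ((↑(g⁻¹) : Matrix (Fin n) (Fin n) k) i j) • X j))) =
      Matrix.mulVec (↑(g⁻¹) : Matrix (Fin n) (Fin n) k) v := by
    ext i; simp [Matrix.mulVec, dotProduct, smul_eval]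
  unfold matAct
  rw [eval_dirD_aeval, h1, h2]

theorem eval_aeval_pMap {n m : ℕ} (p : Fin m → MvPolynomial (Fin n) k) (x : Fin n → k)
    (a : MvPolynomial (Fin m) k) : eval x (aeval p a) = eval (pMap p x) a :=
  eval_aeval' p x a

theorem eval_dirD_eq_sum {n : ℕ} (x w : Fin n → k) (f : MvPolynomial (Fin n) k) :
    eval x (dirD w f) = ∑ j, w j * eval x (dirD (Pi.single j 1) f) := by
  obtain ⟨h, hh⟩ := exists_eq_sum_of_eval x f
  rw [hh, eval_dirD_of_eq_sum]
  simp only [eval_dirD_of_eq_sum]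
  simp [Pi.single_apply]

section Etale

variable {n m : ℕ} {G : Subgroup (Matrix.GeneralLinearGroup (Fin n) k)} [Fintype G]

/-- The stabilizer of `x` in `G` is trivial. -/
def TrivStab (G : Subgroup (Matrix.GeneralLinearGroup (Fin n) k)) (x : Fin n → k) : Prop :=
  ∀ g ∈ G, Matrix.mulVec (g : Matrix (Fin n) (Fin n) k) x = x → g = 1

theorem exists_separating {x : Fin n → k} (hx : TrivStab G x) :
    ∃ q : MvPolynomial (Fin n) k, eval x q = 1 ∧ ∀ g : G, g ≠ 1 →
      eval (Matrix.mulVec (↑((g : Matrix.GeneralLinearGroup (Fin n) k)⁻¹) :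
        Matrix (Fin n) (Fin n) k) x) q = 0 := by
  classical
  obtain ⟨q, h1, h2⟩ := exists_eval_separating x (Finset.image (fun g : G =>
    Matrix.mulVec (↑((g : Matrix.GeneralLinearGroup (Fin n) k)⁻¹) :
      Matrix (Fin n) (Fin n) k) x) {g | g ≠ 1}) (by
    simp only [Finset.mem_image, Finset.mem_filter, Finset.mem_univ, true_and, not_exists,
      not_and]
    intro g hg h
    have := hx _ (G.inv_mem g.2) h
    exact hg (Subtype.ext (inv_eq_one.mp this)))
  exact ⟨q, h1, fun g hg => h2 _ (Finset.mem_image.mpr ⟨g, by simp [hg], rfl⟩)⟩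

theorem eval_semi_separating {x : Fin n → k} {q : MvPolynomial (Fin n) k}
    (hq : ∀ g : G, g ≠ 1 →
      eval (Matrix.mulVec (↑((g : Matrix.GeneralLinearGroup (Fin n) k)⁻¹) :
        Matrix (Fin n) (Fin n) k) x) q = 0) (χ : G →* kˣ) (b : MvPolynomial (Fin n) k) :
    eval x (semi χ (q * b)) = eval x (q * b) := by
  rw [eval_semi, Fintype.sum_eq_single 1]
  · simp
  · intro g hg
    rw [map_mul, hq g hg]; simp

/-- Invariants which are local coordinates at a point with trivial stabilizer. -/
theorem exists_local_coords {x : Fin n → k} (hx : TrivStab G x) :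
    ∃ z : Fin n → MvPolynomial (Fin n) k, ∀ j, z j ∈ invariants G ∧ eval x (z j) = 0 ∧
      ∀ v, eval x (dirD v (z j)) = v j := by
  obtain ⟨q, h1, h2⟩ := exists_separating hx
  refine ⟨fun j => semi (1 : G →* kˣ) (q * (q * (X j - C (x j)))), fun j =>
    ⟨semi_one_mem _, ?_, fun v => ?_⟩⟩
  · rw [eval_semi_separating h2]; simp
  · dsimp only
    rw [semi_apply, map_sum, map_sum, Fintype.sum_eq_single 1]
    · simp [matAct_one, h1]
    · intro g hg
      have h : eval x (matAct (g : Matrix.GeneralLinearGroup (Fin n) k) q) = 0 := by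
        rw [eval_matAct, h2 g hg]
      simp [h]

variable {p : Fin m → MvPolynomial (Fin n) k}

theorem dp_injective (hgen : Algebra.adjoin k (Set.range p) = invariants G)
    {x : Fin n → k} (hx : TrivStab G x) : Function.Injective (dp p x) := by
  rw [← LinearMap.ker_eq_bot, LinearMap.ker_eq_bot']
  intro v hv
  obtain ⟨z, hz⟩ := exists_local_coords hx
  ext j
  obtain ⟨a, ha⟩ := (mem_invariants_iff hgen).mp (hz j).1
  rw [← (hz j).2.2 v, ← ha, eval_dirD_aeval]
  have : (fun i => eval x (dirD v (p i))) = 0 := hv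
  rw [this, show (0 : Fin m → k) = (0 : k) • 0 by simp, dirD_smul]
  simp

theorem mem_range_dp (hgen : Algebra.adjoin k (Set.range p) = invariants G)
    {x : Fin n → k} (hx : TrivStab G x) {v : Fin m → k}
    (hv : ∀ f ∈ relIdeal p, eval (pMap p x) (dirD v f) = 0) : v ∈ LinearMap.range (dp p x) := by
  obtain ⟨q, hq1, hq2⟩ := exists_separating hx
  obtain ⟨z, hz⟩ := exists_local_coords hx
  choose a ha using fun j => (mem_invariants_iff hgen).mp (hz j).1
  -- Cramer rule for the local coordinates
  choose M hM using fun j => exists_eq_sum_of_eval x (z j)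
  simp only [(hz _).2.1, map_zero, zero_add] at hM
  have hMx : (Matrix.of M).map (eval x) = 1 := by
    ext j i
    have h := (hz j).2.2 (Pi.single i 1)
    rw [hM j] at h
    have h' := eval_dirD_of_eq_sum x (Pi.single i 1) (M j) 0
    rw [map_zero, zero_add] at h'
    rw [h'] at h
    simpa [Pi.single_apply, Matrix.one_apply, eq_comm] using h
  set τ := (Matrix.of M).det with hτ
  have hτx : eval x τ = 1 := by
    rw [hτ, RingHom.map_det, RingHom.mapMatrix_apply, hMx, Matrix.det_one]
  have hcr : ∀ i, τ * (X i - C (x i)) = ∑ j, (Matrix.of M).adjugate i j * z j := by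
    intro i
    have h1 : (Matrix.of M).mulVec (fun i => X i - C (x i)) = z := by
      ext1 j
      rw [hM j]
      simp [Matrix.mulVec, dotProduct, mul_comm]
    have h2 : (Matrix.of M).adjugate.mulVec z = τ • (fun i => X i - C (x i)) := by
      rw [← h1, Matrix.mulVec_mulVec, Matrix.adjugate_mul, Matrix.smul_mulVec, Matrix.one_mulVec]
    exact (congrFun h2 i).symm
  -- an invariant vanishing to order two is killed
  have key : ∀ A : MvPolynomial (Fin m) k, eval x (aeval p A) = 0 →
      (∀ w, eval x (dirD w (aeval p A)) = 0) → eval (pMap p x) (dirD v A) = 0 := by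
    intro A hA0 hA1
    obtain ⟨h, hh⟩ := exists_eq_sum_of_eval x (aeval p A)
    have hhx : ∀ i, eval x (h i) = 0 := by
      intro i
      have := hA1 (Pi.single i 1)
      rw [hh, eval_dirD_of_eq_sum] at this
      simpa [Pi.single_apply] using this
    rw [hA0, map_zero, zero_add] at hh
    set b : Fin n → MvPolynomial (Fin n) k := fun j => ∑ i, (Matrix.of M).adjugate i j * h i
    have hb : ∀ j, eval x (b j) = 0 := fun j => by simp [b, hhx]
    have hτA : τ * aeval p A = ∑ j, z j * b j := by
      rw [hh, Finset.mul_sum]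
      simp only [← mul_assoc, hcr, b, Finset.mul_sum, Finset.sum_mul]
      rw [Finset.sum_comm]
      refine Finset.sum_congr rfl fun j _ => Finset.sum_congr rfl fun i _ => by ring
    obtain ⟨r, hr⟩ := (mem_invariants_iff hgen).mp (semi_one_mem (G := G) (q * τ))
    choose s hs using fun j => (mem_invariants_iff hgen).mp (semi_one_mem (G := G) (q * b j))
    have hrx : eval (pMap p x) r = 1 := by
      rw [← eval_aeval_pMap, hr, eval_semi_separating hq2]; simp [hq1, hτx]
    have hsx : ∀ j, eval (pMap p x) (s j) = 0 := by
      intro j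
      rw [← eval_aeval_pMap, hs, eval_semi_separating hq2]; simp [hb]
    have hax : ∀ j, eval (pMap p x) (a j) = 0 := by
      intro j
      rw [← eval_aeval_pMap, ha, (hz j).2.1]
    have hrel : A * r - ∑ j, a j * s j ∈ relIdeal p := by
      rw [relIdeal, RingHom.mem_ker]
      simp only [map_sub, map_mul, map_sum, hr, ha, hs]
      rw [← semi_mul _ ((mem_invariants_iff hgen).mpr ⟨A, rfl⟩), mul_left_comm,
        mul_comm _ τ, hτA, Finset.mul_sum, map_sum, sub_eq_zero]
      refine Finset.sum_congr rfl fun j _ => ?_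
      rw [mul_left_comm, semi_mul _ (hz j).1]
    have := hv _ hrel
    have hA0' : eval (pMap p x) A = 0 := by rw [← eval_aeval_pMap, hA0]
    simpa [hrx, hsx, hax, hA0'] using this
  refine ⟨fun j => eval (pMap p x) (dirD v (a j)), ?_⟩
  ext i
  have := key (X i - C (eval x (p i)) - ∑ j, C (eval x (dirD (Pi.single j 1) (p i))) * a j) ?_ ?_
  · simp only [map_sub, dirD_X, dirD_C, map_sum, Derivation.leibniz, smul_eq_mul, eval_C,
      map_mul, mul_zero, add_zero, sub_zero] at this
    rw [sub_eq_zero.mp this]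
    exact (eval_dirD_eq_sum x _ (p i)).trans (Finset.sum_congr rfl fun j _ => mul_comm _ _)
  · simp only [map_sub, aeval_X, aeval_C, map_sum, map_mul, ha, (hz _).2.1, mul_zero,
      Finset.sum_const_zero, algebraMap_eq, eval_C, sub_self]
  · intro w
    simp only [map_sub, aeval_X, aeval_C, map_sum, map_mul, ha, Derivation.leibniz, dirD_C,
      algebraMap_eq, smul_eq_mul, (hz _).2.2, mul_zero, add_zero, eval_C, sub_zero]
    rw [sub_eq_zero, eval_dirD_eq_sum]
    exact Finset.sum_congr rfl fun j _ => mul_comm _ _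

end Etale

/-! ### Linear algebra -/

theorem exists_forall_notMem {E : Type} [AddCommGroup E] [Module k E] [Infinite k] {ι : Type}
    [Finite ι] {p : ι → Submodule k E} (hp : ∀ i, p i ≠ ⊤) : ∃ v, ∀ i, v ∉ p i := by
  by_contra! h
  obtain ⟨i, hi⟩ := Subspace.exists_eq_top_of_iUnion_eq_univ (p := p)
    (Set.eq_univ_of_forall fun v => Set.mem_iUnion.mpr (h v))
  exact hp i hi

/-- A unipotent element of square-zero type which has finite order is trivial. -/
theorem eq_one_of_pow_eq_one_of_sq {R : Type} [Ring R] [Algebra k R] [CharZero k] {a : R} {M : ℕ}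
    (hM : 0 < M) (ha : a ^ M = 1) (hsq : (a - 1) * (a - 1) = 0) : a = 1 := by
  have h : ∀ i : ℕ, a ^ i = 1 + (i : k) • (a - 1) := by
    intro i
    induction i with
    | zero => simp
    | succ i ih =>
      rw [pow_succ, ih]
      have : a = 1 + (a - 1) := by abel
      conv_lhs => rw [this]
      simp only [add_sub_cancel_left, mul_add, add_mul, mul_one, one_mul, smul_mul_assoc, hsq,
        smul_zero, add_zero, Nat.cast_add, Nat.cast_one, add_smul, one_smul]
      abel
  have h2 := h M
  rw [ha, left_eq_add] at h2
  have hM' : (M : k) ≠ 0 := by exact_mod_cast hM.ne'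
  exact sub_eq_zero.mp ((smul_eq_zero.mp h2).resolve_left hM')

section Transfer

variable {E F : Type} [AddCommGroup E] [Module k E] [AddCommGroup F] [Module k F]

theorem finrank_map_of_disjoint (f : E →ₗ[k] F) (p : Submodule k E)
    (h : Disjoint (LinearMap.ker f) p) :
    Module.finrank k (p.map f) = Module.finrank k p :=
  (LinearEquiv.ofBijective (f.submoduleMap p)
    ⟨LinearMap.submoduleMap_injective_of_injOn (LinearMap.disjoint_ker_iff_injOn.mp h.symm),
      f.submoduleMap_surjective p⟩).finrank_eq.symm

theorem pow_transfer {φ : E →ₗ[k] F} {S : Module.End k E} {Q : Module.End k F}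
    (hcomm : ∀ v, φ (S v) = Q (φ v)) (j : ℕ) (v : E) : φ ((S ^ j) v) = (Q ^ j) (φ v) := by
  induction j with
  | zero => simp
  | succ j ih => rw [pow_succ', pow_succ', Module.End.mul_apply, Module.End.mul_apply, hcomm, ih]

theorem pow_eq_one_transfer [CharZero k] {φ : E →ₗ[k] F} (hφ : Function.Injective φ)
    {S : Module.End k E} {Q : Module.End k F} (hcomm : ∀ v, φ (S v) = Q (φ v))
    (hQ : LinearMap.range (Q - 1) ≤ LinearMap.range φ) {M : ℕ} (hM : 0 < M) (hQM : Q ^ M = 1)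
    (j : ℕ) : Q ^ j = 1 ↔ S ^ j = 1 := by
  constructor
  · intro h
    ext v
    apply hφ
    rw [pow_transfer hcomm, h]; rfl
  · intro h
    refine eq_one_of_pow_eq_one_of_sq (k := k) hM
      (by rw [← pow_mul, mul_comm, pow_mul, hQM, one_pow]) ?_
    have h2 : ∀ v, (Q ^ j - 1) (φ v) = 0 := by
      intro v
      rw [LinearMap.sub_apply, ← pow_transfer hcomm, h]; simp
    ext v
    rw [Module.End.mul_apply, LinearMap.zero_apply]
    have : Q ^ j - 1 = (Q - 1) * ∑ i ∈ Finset.range j, Q ^ i := (mul_geom_sum Q j).symm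
    obtain ⟨w, hw⟩ := hQ (LinearMap.mem_range_self (Q - 1) ((∑ i ∈ Finset.range j, Q ^ i) v))
    rw [← Module.End.mul_apply, ← this] at hw
    rw [← hw, h2]

theorem disjoint_ker_range_sub_one [CharZero k] {Q : Module.End k F} {M : ℕ} (hM : 0 < M)
    (hQM : Q ^ M = 1) : Disjoint (LinearMap.ker (Q - 1)) (LinearMap.range (Q - 1)) := by
  rw [Submodule.disjoint_def]
  rintro _ hy ⟨z, rfl⟩
  set y := (Q - 1) z with hyz
  have hQy : Q y = y := by
    rw [LinearMap.mem_ker, LinearMap.sub_apply, sub_eq_zero] at hy; exact hy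
  have hQz : Q z = z + y := by rw [hyz]; simp
  have h : ∀ i : ℕ, (Q ^ i) z = z + (i : k) • y := by
    intro i
    induction i with
    | zero => simp
    | succ i ih =>
      rw [pow_succ', Module.End.mul_apply, ih, map_add, map_smul, hQy, hQz, Nat.cast_add,
        Nat.cast_one, add_smul, one_smul]
      abel
  have h2 := h M
  rw [hQM, Module.End.one_apply, left_eq_add] at h2
  have hM' : (M : k) ≠ 0 := by exact_mod_cast hM.ne'
  exact (smul_eq_zero.mp h2).resolve_left hM'

theorem finrank_range_transfer [CharZero k] [FiniteDimensional k F] {φ : E →ₗ[k] F}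
    (hφ : Function.Injective φ)
    {S : Module.End k E} {Q : Module.End k F} (hcomm : ∀ v, φ (S v) = Q (φ v))
    (hQ : LinearMap.range (Q - 1) ≤ LinearMap.range φ) {M : ℕ} (hM : 0 < M) (hQM : Q ^ M = 1) :
    Module.finrank k (LinearMap.range (Q - 1)) = Module.finrank k (LinearMap.range (S - 1)) := by
  have h1 : (LinearMap.range φ).map (Q - 1) = (LinearMap.range (S - 1)).map φ := by
    rw [← LinearMap.range_comp, ← LinearMap.range_comp]
    congr 1
    ext v; simp [hcomm]
  have h2 : Module.finrank k ((LinearMap.range (S - 1)).map φ) =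
      Module.finrank k (LinearMap.range (S - 1)) :=
    finrank_map_of_disjoint _ _ (by rw [LinearMap.ker_eq_bot.mpr hφ]; exact disjoint_bot_left)
  have h3 : Module.finrank k ((LinearMap.range (Q - 1)).map (Q - 1)) =
      Module.finrank k (LinearMap.range (Q - 1)) :=
    finrank_map_of_disjoint _ _ (disjoint_ker_range_sub_one hM hQM)
  refine le_antisymm ?_ ?_
  · rw [← h3, ← h2, ← h1]
    exact Submodule.finrank_mono (Submodule.map_mono hQ)
  · rw [← h2, ← h1]
    exact Submodule.finrank_mono (LinearMap.map_le_range)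

end Transfer

theorem det_transfer {n m : ℕ} {φ : (Fin n → k) →ₗ[k] (Fin m → k)} (hφ : Function.Injective φ)
    {S : Matrix (Fin n) (Fin n) k} {Q : Matrix (Fin m) (Fin m) k}
    (hcomm : ∀ v, φ (S.mulVec v) = Q.mulVec (φ v))
    (hQ : LinearMap.range (Matrix.toLin' Q - 1) ≤ LinearMap.range φ) : Q.det = S.det := by
  obtain ⟨ψ, hψ⟩ : ∃ ψ : (Fin m → k) →ₗ[k] (Fin n → k), φ ∘ₗ ψ = Matrix.toLin' Q - 1 := by
    obtain ⟨r, hr⟩ := φ.exists_leftInverse_of_injective (LinearMap.ker_eq_bot.mpr hφ)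
    refine ⟨r ∘ₗ (Matrix.toLin' Q - 1), ?_⟩
    refine LinearMap.ext fun v => ?_
    obtain ⟨w, hw⟩ := hQ (LinearMap.mem_range_self (Matrix.toLin' Q - 1) v)
    rw [LinearMap.comp_apply, LinearMap.comp_apply, ← hw, ← LinearMap.comp_apply r, hr]; rfl
  have hψ' : ψ ∘ₗ φ = Matrix.toLin' S - 1 := by
    refine LinearMap.ext fun v => hφ ?_
    rw [LinearMap.comp_apply, ← LinearMap.comp_apply φ, hψ]
    simp [hcomm]
  have e1 : Q = 1 + LinearMap.toMatrix' φ * LinearMap.toMatrix' ψ := by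
    rw [← LinearMap.toMatrix'_comp, hψ, map_sub, LinearMap.toMatrix'_toLin', Module.End.one_eq_id,
      LinearMap.toMatrix'_id]
    abel
  have e2 : S = 1 + LinearMap.toMatrix' ψ * LinearMap.toMatrix' φ := by
    rw [← LinearMap.toMatrix'_comp, hψ', map_sub, LinearMap.toMatrix'_toLin', Module.End.one_eq_id,
      LinearMap.toMatrix'_id]
    abel
  rw [e1, e2, Matrix.det_one_add_mul_comm]

theorem eval_smul_of_isHomogeneous {σ : Type} [Fintype σ] {f : MvPolynomial σ k} {e : ℕ}
    (hf : f.IsHomogeneous e) (t : k) (x : σ → k) : eval (t • x) f = t ^ e * eval x f := by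
  rw [eval_eq', eval_eq', Finset.mul_sum]
  refine Finset.sum_congr rfl fun d hd => ?_
  have : ∑ i, d i = e := by
    rw [← hf (mem_support_iff.mp hd), Finsupp.weight_apply, Finsupp.sum_fintype] <;> simp
  simp only [Pi.smul_apply, smul_eq_mul, mul_pow, Finset.prod_mul_distrib,
    Finset.prod_pow_eq_pow_sum, this]
  ring

/-! ### The action on the generators -/

theorem polyAct_X {m : ℕ} (M : Fin m → Fin m → k) (i : Fin m) :
    polyAct M (X i) = ∑ j, M i j • X j := by
  simp [polyAct]

section Setup

variable {n m : ℕ} {Wt G : Subgroup (Matrix.GeneralLinearGroup (Fin n) k)}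
  {p : Fin m → MvPolynomial (Fin n) k} {d : Fin m → ℕ} {c : ↥Wt → Fin m → Fin m → k}

theorem QuotSetup.linearIndependent (h : QuotSetup Wt G p d c) : LinearIndependent k p := by
  rw [Fintype.linearIndependent_iff]
  intro a ha i
  have := h.minimal a (by rw [ha]; exact zero_mem _)
  rw [this]; rfl

theorem QuotSetup.coeff_eq (h : QuotSetup Wt G p d c) {a b : Fin m → k}
    (hab : ∑ i, a i • p i = ∑ i, b i • p i) : a = b := by
  ext i
  have := Fintype.linearIndependent_iff.mp h.linearIndependent (fun i => a i - b i)
    (by simp [sub_smul, hab]) i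
  exact sub_eq_zero.mp this

theorem QuotSetup.c_mul (h : QuotSetup Wt G p d c) (w w' : ↥Wt) :
    (Matrix.of (c (w * w')) : Matrix (Fin m) (Fin m) k) = Matrix.of (c w') * Matrix.of (c w) := by
  ext1 i
  refine fun j => congrFun (h.coeff_eq (a := c (w * w') i)
    (b := (Matrix.of (c w') * Matrix.of (c w)) i) ?_) j
  rw [← h.equivar, Subgroup.coe_mul, matAct_mul, h.equivar, map_sum]
  simp only [map_smul, h.equivar, Matrix.mul_apply, Matrix.of_apply, Finset.sum_smul,
    Finset.smul_sum, smul_smul]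
  rw [Finset.sum_comm]

theorem QuotSetup.c_eq_one (h : QuotSetup Wt G p d c) {w : ↥Wt}
    (hw : (w : Matrix.GeneralLinearGroup (Fin n) k) ∈ G) :
    (Matrix.of (c w) : Matrix (Fin m) (Fin m) k) = 1 := by
  ext1 i
  refine fun j => congrFun (h.coeff_eq (a := c w i)
    (b := (1 : Matrix (Fin m) (Fin m) k) i) ?_) j
  have hp : p i ∈ invariants G := h.gen ▸ Algebra.subset_adjoin ⟨i, rfl⟩
  rw [← h.equivar, hp _ hw]
  simp [Matrix.one_apply]

/-- The representation of `Wt` on `V`. -/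
def QuotSetup.rep (h : QuotSetup Wt G p d c) : ↥Wt →* Matrix (Fin m) (Fin m) k where
  toFun := qMat c
  map_one' := by rw [qMat, inv_one]; exact h.c_eq_one G.one_mem
  map_mul' w w' := by rw [qMat, qMat, qMat, mul_inv_rev, h.c_mul]

theorem QuotSetup.qMat_eq_one (h : QuotSetup Wt G p d c) {w : ↥Wt}
    (hw : (w : Matrix.GeneralLinearGroup (Fin n) k) ∈ G) : qMat c w = 1 :=
  h.c_eq_one (G.inv_mem hw)

theorem QuotSetup.matAct_inv (h : QuotSetup Wt G p d c) (w : ↥Wt) (i : Fin m) :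
    matAct ((w : Matrix.GeneralLinearGroup (Fin n) k)⁻¹) (p i) = ∑ j, qMat c w i j • p j :=
  h.equivar w⁻¹ i

theorem QuotSetup.qMat_pMap (h : QuotSetup Wt G p d c) (w : ↥Wt) (x : Fin n → k) :
    (qMat c w).mulVec (pMap p x) = pMap p ((matOf w).mulVec x) := by
  ext i
  have := congrArg (eval x) (h.matAct_inv w i)
  rw [eval_matAct, inv_inv] at this
  simpa [pMap, Matrix.mulVec, dotProduct, matOf, smul_eval] using this.symm

theorem QuotSetup.qMat_dp (h : QuotSetup Wt G p d c) (w : ↥Wt) (x v : Fin n → k) :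
    (qMat c w).mulVec (dp p x v) = dp p ((matOf w).mulVec x) ((matOf w).mulVec v) := by
  ext i
  have := congrArg (eval x ∘ dirD v) (h.matAct_inv w i)
  simp only [Function.comp_apply] at this
  rw [eval_dirD_matAct, inv_inv] at this
  simp only [dp, LinearMap.coe_mk, AddHom.coe_mk, matOf, this]
  simp [Matrix.mulVec, dotProduct, smul_eval]

theorem QuotSetup.aeval_polyAct (h : QuotSetup Wt G p d c) (w : ↥Wt) (f : MvPolynomial (Fin m) k) :
    aeval p (polyAct (c w) f) = matAct (w : Matrix.GeneralLinearGroup (Fin n) k) (aeval p f) := by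
  have : (aeval p).comp (polyAct (c w)) =
      (matAct (w : Matrix.GeneralLinearGroup (Fin n) k)).comp (aeval p) := by
    ext i : 1
    simp only [AlgHom.comp_apply, polyAct_X, aeval_X, h.equivar, map_sum, map_smul]
  exact congrArg (fun φ => φ f) this

theorem QuotSetup.polyAct_mul (h : QuotSetup Wt G p d c) (w w' : ↥Wt)
    (f : MvPolynomial (Fin m) k) :
    polyAct (c (w * w')) f = polyAct (c w) (polyAct (c w') f) := by
  have : polyAct (c (w * w')) = (polyAct (c w)).comp (polyAct (c w')) := by
    ext i : 1
    have hc : ∀ j, c (w * w') i j = ∑ l, c w' i l * c w l j := fun j => by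
      simpa [Matrix.mul_apply] using congrFun (congrFun (h.c_mul w w') i) j
    simp only [AlgHom.comp_apply, polyAct_X, map_sum, map_smul, hc, Finset.sum_smul,
      Finset.smul_sum, smul_smul]
    rw [Finset.sum_comm]
  rw [this]; rfl

theorem eval_dirD_polyAct {w : ↥Wt} (y v : Fin m → k) (f : MvPolynomial (Fin m) k) :
    eval y (dirD v (polyAct (c w⁻¹) f)) =
      eval ((qMat c w).mulVec y) (dirD ((qMat c w).mulVec v) f) := by
  have h1 : (fun i => eval y (∑ j, c w⁻¹ i j • X j)) = (qMat c w).mulVec y := by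
    ext i; simp [qMat, Matrix.mulVec, dotProduct, smul_eval]
  have h2 : (fun i => eval y (dirD v (∑ j, c w⁻¹ i j • X j))) = (qMat c w).mulVec v := by
    ext i; simp [qMat, Matrix.mulVec, dotProduct, smul_eval]
  unfold polyAct
  rw [eval_dirD_aeval, h1, h2]

/-- Up to a multiplier which is a unit at the origin, the ideal of relations is generated by
`Wt`-invariant relations. -/
theorem QuotSetup.exists_invariant_relations [CharZero k] (h : QuotSetup Wt G p d c)
    (htriv : TrivialConormal Wt p c) :
    ∃ a : MvPolynomial (Fin m) k, a - 1 ∈ idealPlus k m ∧ ∀ f ∈ relIdeal p,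
      a * f ∈ Ideal.span {f | f ∈ relIdeal p ∧ ∀ w, polyAct (c w) f = f} := by
  have : Finite ↥Wt := h.finite
  have := Fintype.ofFinite ↥Wt
  set S : Set (MvPolynomial (Fin m) k) := {f | f ∈ relIdeal p ∧ ∀ w, polyAct (c w) f = f} with hS
  have hle : relIdeal p ≤ Ideal.span S ⊔ idealPlus k m • relIdeal p := by
    intro f hf
    have hcard : (Fintype.card ↥Wt : k) ≠ 0 := by exact_mod_cast Fintype.card_ne_zero
    set f' : MvPolynomial (Fin m) k := (Fintype.card ↥Wt : k)⁻¹ • ∑ w, polyAct (c w) f with hf'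
    have hmem : ∀ w, polyAct (c w) f ∈ relIdeal p := by
      intro w
      rw [relIdeal, RingHom.mem_ker] at hf ⊢
      exact (h.aeval_polyAct w f).trans (by erw [hf]; exact map_zero _)
    have h1 : f' ∈ S := by
      refine ⟨?_, fun u => ?_⟩
      · rw [hf', smul_eq_C_mul]
        exact Ideal.mul_mem_left _ _ (sum_mem fun w _ => hmem w)
      · rw [hf', map_smul, map_sum]
        congr 1
        refine Fintype.sum_equiv (Equiv.mulLeft u) _ _ fun w => ?_
        rw [← h.polyAct_mul]; rfl
    have h2 : f - f' ∈ idealPlus k m • relIdeal p := by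
      have : f - f' = C (-(Fintype.card ↥Wt : k)⁻¹) * ∑ w, (polyAct (c w) f - f) := by
        rw [Finset.sum_sub_distrib, Finset.sum_const, Finset.card_univ, hf', ← smul_eq_C_mul,
          smul_sub, ← Nat.cast_smul_eq_nsmul k, smul_smul, neg_mul, inv_mul_cancel₀ hcard, neg_smul,
          neg_smul, one_smul]
        abel
      rw [this]
      exact Ideal.mul_mem_left _ _ (sum_mem fun w _ => htriv w f hf)
    rw [← sub_add_cancel f f']
    exact add_mem (Submodule.mem_sup_right h2) (Submodule.mem_sup_left (Ideal.subset_span h1))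
  obtain ⟨a, ha, hI⟩ := Submodule.exists_sub_one_mem_and_smul_le_of_fg_of_le_sup
    (I := idealPlus k m) (N := Ideal.span S) (N' := relIdeal p) (P := relIdeal p)
    (IsNoetherian.noetherian _) le_rfl hle
  refine ⟨a, ha, fun f hf => hI ?_⟩
  exact Submodule.smul_mem_pointwise_smul f a _ hf

/-- If `s` fixes a point `x` with trivial stabilizer in `G` then `s - 1` on `V` has image in the
tangent space of the quotient at the image of `x`. -/
theorem QuotSetup.range_le [CharZero k] (h : QuotSetup Wt G p d c) {a : MvPolynomial (Fin m) k}
    (ha : ∀ f ∈ relIdeal p,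
      a * f ∈ Ideal.span {f | f ∈ relIdeal p ∧ ∀ w, polyAct (c w) f = f})
    {x : Fin n → k} (hx : TrivStab G x) (hax : eval (pMap p x) a ≠ 0) {s : ↥Wt}
    (hs : (matOf s).mulVec x = x) :
    LinearMap.range (Matrix.toLin' (qMat c s) - 1) ≤ LinearMap.range (dp p x) := by
  have : Finite ↥Wt := h.finite
  have : Finite ↥G := Finite.of_injective _ (Subgroup.inclusion_injective h.le)
  have := Fintype.ofFinite ↥G
  rintro _ ⟨v, rfl⟩
  refine mem_range_dp h.gen hx fun f hf => ?_
  have hker : ∀ f ∈ relIdeal p, eval (pMap p x) f = 0 := fun f hf => by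
    rw [← eval_aeval_pMap]
    rw [relIdeal, RingHom.mem_ker] at hf
    exact (congrArg (eval x) hf).trans (map_zero _)
  set u := (Matrix.toLin' (qMat c s) - 1) v with hu
  have huv : u + v = (qMat c s).mulVec v := by rw [hu]; simp
  have hspan : ∀ f ∈ Ideal.span {f | f ∈ relIdeal p ∧ ∀ w, polyAct (c w) f = f},
      eval (pMap p x) f = 0 ∧ eval (pMap p x) (dirD u f) = 0 := by
    intro f hf
    induction hf using Submodule.span_induction with
    | mem f hf =>
      refine ⟨hker f hf.1, ?_⟩
      have h1 := eval_dirD_polyAct (c := c) (w := s) (pMap p x) v f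
      rw [hf.2, h.qMat_pMap, hs, ← huv, dirD_add, map_add, right_eq_add] at h1
      exact h1
    | zero => simp
    | add f g _ _ hf hg => simp [hf.1, hf.2, hg.1, hg.2]
    | smul b f _ hf => simp [hf.1, hf.2]
  have := (hspan _ (ha f hf)).2
  rw [Derivation.leibniz] at this
  simpa [hker f hf, hax] using this

end Setup

/-! ### Reflections and their images -/

/-- The fixed space of a matrix. -/
def fixK {n : ℕ} (M : Matrix (Fin n) (Fin n) k) : Submodule k (Fin n → k) :=
  LinearMap.ker (Matrix.toLin' M - LinearMap.id)

theorem mem_fixK {n : ℕ} {M : Matrix (Fin n) (Fin n) k} {x : Fin n → k} :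
    x ∈ fixK M ↔ M.mulVec x = x := by
  simp [fixK, sub_eq_zero]

theorem fixK_eq_top {n : ℕ} {M : Matrix (Fin n) (Fin n) k} : fixK M = ⊤ ↔ M = 1 := by
  refine ⟨fun h => ?_, fun h => ?_⟩
  · apply Matrix.toLin'.injective
    refine LinearMap.ext fun x => ?_
    have : x ∈ fixK M := h ▸ Submodule.mem_top
    rw [mem_fixK] at this
    simpa using this
  · rw [eq_top_iff]
    intro x _
    rw [mem_fixK, h, Matrix.one_mulVec]

theorem finrank_fixK_lt {n : ℕ} {M : Matrix (Fin n) (Fin n) k} (hM : M ≠ 1) :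
    Module.finrank k (fixK M) < n := by
  have := Submodule.finrank_lt (s := fixK M) (fun h => hM (fixK_eq_top.mp h))
  simpa using this

theorem isOfFinOrder_coe {n : ℕ} {G : Subgroup (Matrix.GeneralLinearGroup (Fin n) k)}
    (hG : (G : Set (Matrix.GeneralLinearGroup (Fin n) k)).Finite)
    {g : Matrix.GeneralLinearGroup (Fin n) k} (hg : g ∈ G) :
    IsOfFinOrder (g : Matrix (Fin n) (Fin n) k) := by
  have : Finite G := hG
  exact (Units.coeHom _).isOfFinOrder (G.subtype.isOfFinOrder
    (isOfFinOrder_of_finite (⟨g, hg⟩ : G)))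

theorem constantCoeff_of_mem_idealPlus {m : ℕ} {f : MvPolynomial (Fin m) k}
    (hf : f ∈ idealPlus k m) : constantCoeff f = 0 := by
  have : idealPlus k m ≤ RingHom.ker (constantCoeff : MvPolynomial (Fin m) k →+* k) := by
    rw [idealPlus, Ideal.span_le]
    rintro _ ⟨i, rfl⟩
    simp
  exact this hf

section Setup

variable {n m : ℕ} {Wt G : Subgroup (Matrix.GeneralLinearGroup (Fin n) k)}
  {p : Fin m → MvPolynomial (Fin n) k} {d : Fin m → ℕ} {c : ↥Wt → Fin m → Fin m → k}

theorem QuotSetup.finiteG (h : QuotSetup Wt G p d c) :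
    (G : Set (Matrix.GeneralLinearGroup (Fin n) k)).Finite :=
  h.finite.subset h.le

theorem QuotSetup.finrank_fixK_le (h : QuotSetup Wt G p d c)
    (hnorefl : ∀ g ∈ G, ¬ IsReflection ((g : Matrix (Fin n) (Fin n) k)))
    {g : Matrix.GeneralLinearGroup (Fin n) k} (hg : g ∈ G) (hg1 : g ≠ 1) :
    Module.finrank k (fixK (g : Matrix (Fin n) (Fin n) k)) + 2 ≤ n := by
  have h1 := finrank_fixK_lt (M := (g : Matrix (Fin n) (Fin n) k))
    (fun h => hg1 (Units.ext h))
  have h2 : Module.finrank k (fixK (g : Matrix (Fin n) (Fin n) k)) + 1 ≠ n := fun hh =>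
    hnorefl g hg ⟨isOfFinOrder_coe h.finiteG hg, hh⟩
  omega

theorem QuotSetup.pMap_smul (h : QuotSetup Wt G p d c) (t : k) (x : Fin n → k) :
    pMap p (t • x) = fun i => t ^ d i * pMap p x i := by
  ext i
  exact eval_smul_of_isHomogeneous (h.homog i) t x

theorem QuotSetup.exists_good_point [CharZero k] (h : QuotSetup Wt G p d c)
    (hnorefl : ∀ g ∈ G, ¬ IsReflection ((g : Matrix (Fin n) (Fin n) k)))
    {a : MvPolynomial (Fin m) k} (ha : a - 1 ∈ idealPlus k m) {s : ↥Wt}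
    (hs : IsReflection (matOf s)) :
    ∃ x, TrivStab G x ∧ eval (pMap p x) a ≠ 0 ∧ (matOf s).mulVec x = x := by
  have : Finite ↥G := h.finiteG
  obtain ⟨⟨x, hxH⟩, hx⟩ := exists_forall_notMem (k := k) (E := fixK (matOf s))
    (ι := {g : ↥G // g ≠ 1})
    (p := fun g => (fixK ((g.1 : Matrix.GeneralLinearGroup (Fin n) k) :
      Matrix (Fin n) (Fin n) k)).comap (fixK (matOf s)).subtype) (fun g htop => by
      rw [Submodule.comap_subtype_eq_top] at htop
      have h1 := Submodule.finrank_mono htop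
      have h2 := h.finrank_fixK_le hnorefl g.1.2 (fun h => g.2 (Subtype.ext h))
      have h3 : Module.finrank k (fixK (matOf s)) + 1 = n := hs.2
      omega)
  have hstab : TrivStab G x := by
    intro g hg hgx
    by_contra hne
    exact hx ⟨⟨g, hg⟩, fun h => hne (congrArg Subtype.val h)⟩ (mem_fixK.mpr hgx)
  rw [mem_fixK] at hxH
  set P : Polynomial k := aeval (fun i => Polynomial.X ^ d i * Polynomial.C (pMap p x i)) a with hP
  have hPt : ∀ t, P.eval t = eval (pMap p (t • x)) a := by
    intro t
    have h1 := map_aeval (fun i => Polynomial.X ^ d i * Polynomial.C (pMap p x i))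
      (Polynomial.evalRingHom t) a
    rw [← hP, Polynomial.coe_evalRingHom] at h1
    rw [h1, h.pMap_smul, coe_eval₂Hom, eval, coe_eval₂Hom]
    congr 1
    · ext; simp
    · ext i
      simp only [Polynomial.eval_mul, Polynomial.eval_pow,
        Polynomial.eval_X, Polynomial.eval_C]
  have hP0 : P.eval 0 = 1 := by
    rw [hPt, h.pMap_smul]
    have : (fun i => (0 : k) ^ d i * pMap p x i) = 0 := by
      ext i; simp [(h.dpos i).ne']
    have h1 := constantCoeff_of_mem_idealPlus ha
    rw [map_sub, map_one, sub_eq_zero] at h1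
    rw [this, eval_zero, h1]
  have hPX : P * Polynomial.X ≠ 0 := by
    refine mul_ne_zero (fun h => ?_) Polynomial.X_ne_zero
    rw [h] at hP0; simp at hP0
  obtain ⟨t, ht⟩ : ∃ t, (P * Polynomial.X).eval t ≠ 0 := by
    by_contra! hh
    exact hPX (Polynomial.funext fun t => by rw [hh t]; simp)
  rw [Polynomial.eval_mul, Polynomial.eval_X] at ht
  have ht0 : t ≠ 0 := right_ne_zero_of_mul ht
  refine ⟨t • x, fun g hg hgx => hstab g hg ?_, ?_, ?_⟩
  · rw [Matrix.mulVec_smul] at hgx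
    exact smul_right_injective _ ht0 hgx
  · rw [← hPt]; exact left_ne_zero_of_mul ht
  · rw [Matrix.mulVec_smul, hxH]

/-- The comparison of a reflection with its image, at a point of its hyperplane. -/
theorem QuotSetup.exists_transfer [CharZero k] (h : QuotSetup Wt G p d c)
    (htriv : TrivialConormal Wt p c)
    (hnorefl : ∀ g ∈ G, ¬ IsReflection ((g : Matrix (Fin n) (Fin n) k)))
    {s : ↥Wt} (hs : IsReflection (matOf s)) :
    ∃ φ : (Fin n → k) →ₗ[k] (Fin m → k), Function.Injective φ ∧
      (∀ v, φ ((matOf s).mulVec v) = (qMat c s).mulVec (φ v)) ∧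
      LinearMap.range (Matrix.toLin' (qMat c s) - 1) ≤ LinearMap.range φ := by
  have : Finite ↥G := h.finiteG
  have := Fintype.ofFinite ↥G
  obtain ⟨a, ha1, ha2⟩ := h.exists_invariant_relations htriv
  obtain ⟨x, hx, hax, hsx⟩ := h.exists_good_point hnorefl ha1 hs
  refine ⟨dp p x, dp_injective h.gen hx, fun v => ?_, h.range_le ha2 hx hax hsx⟩
  rw [h.qMat_dp, hsx]

theorem QuotSetup.det_eq_of_isReflection [CharZero k] (h : QuotSetup Wt G p d c)
    (htriv : TrivialConormal Wt p c)
    (hnorefl : ∀ g ∈ G, ¬ IsReflection ((g : Matrix (Fin n) (Fin n) k)))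
    {s : ↥Wt} (hs : IsReflection (matOf s)) : (qMat c s).det = (matOf s).det := by
  obtain ⟨φ, h1, h2, h3⟩ := h.exists_transfer htriv hnorefl hs
  exact det_transfer h1 h2 h3

theorem QuotSetup.isReflection_qMat [CharZero k] (h : QuotSetup Wt G p d c)
    (htriv : TrivialConormal Wt p c)
    (hnorefl : ∀ g ∈ G, ¬ IsReflection ((g : Matrix (Fin n) (Fin n) k)))
    {s : ↥Wt} (hs : IsReflection (matOf s)) :
    IsReflection (qMat c s) ∧ orderOf (qMat c s) = orderOf (matOf s) := by
  obtain ⟨φ, h1, h2, h3⟩ := h.exists_transfer htriv hnorefl hs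
  have : Finite ↥Wt := h.finite
  have hfin : IsOfFinOrder (qMat c s) := h.rep.isOfFinOrder (isOfFinOrder_of_finite s)
  obtain ⟨M, hM, hQM⟩ := isOfFinOrder_iff_pow_eq_one.mp hfin
  have hQM' : Matrix.toLin' (qMat c s) ^ M = 1 := by
    rw [← Matrix.toLin'_pow, hQM, Matrix.toLin'_one]; rfl
  have hcomm : ∀ v, φ (Matrix.toLin' (matOf s) v) = Matrix.toLin' (qMat c s) (φ v) := fun v => by
    simpa using h2 v
  have hrank := finrank_range_transfer h1 hcomm h3 hM hQM'
  have r1 := LinearMap.finrank_range_add_finrank_ker (Matrix.toLin' (qMat c s) - 1)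
  have r2 := LinearMap.finrank_range_add_finrank_ker (Matrix.toLin' (matOf s) - 1)
  rw [Module.finrank_fin_fun] at r1 r2
  have hs2 := hs.2
  refine ⟨⟨hfin, ?_⟩, ?_⟩
  · rw [← Module.End.one_eq_id] at hs2 ⊢
    omega
  · apply orderOf_eq_orderOf_iff.mpr
    intro j
    have := pow_eq_one_transfer h1 hcomm h3 hM hQM' j
    rw [← Matrix.toLin'_pow, ← Matrix.toLin'_pow, Module.End.one_eq_id, Module.End.one_eq_id,
      ← Matrix.toLin'_one, ← Matrix.toLin'_one, Matrix.toLin'.injective.eq_iff,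
      Matrix.toLin'.injective.eq_iff] at this
    exact this

theorem QuotSetup.det_eq_one [CharZero k] (h : QuotSetup Wt G p d c)
    (htriv : TrivialConormal Wt p c)
    (hnorefl : ∀ g ∈ G, ¬ IsReflection ((g : Matrix (Fin n) (Fin n) k)))
    {g : Matrix.GeneralLinearGroup (Fin n) k} (hg : g ∈ G) :
    (g : Matrix (Fin n) (Fin n) k).det = 1 := by
  have hdet : ∀ w (hw : w ∈ Wt), (qMat c ⟨w, hw⟩).det = (w : Matrix (Fin n) (Fin n) k).det := by
    intro w hw
    have hw' := hw
    rw [← h.reflGroup] at hw'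
    have hsub : ∀ {w}, w ∈ Subgroup.closure
        {g | g ∈ Wt ∧ IsReflection ((g : Matrix (Fin n) (Fin n) k))} → w ∈ Wt :=
      fun hw => by rw [← h.reflGroup]; exact hw
    suffices ∀ hw, (qMat c ⟨w, hw⟩).det = (w : Matrix (Fin n) (Fin n) k).det from this hw
    clear hw
    induction hw' using Subgroup.closure_induction with
    | mem s hs => exact fun hw => h.det_eq_of_isReflection htriv hnorefl (s := ⟨s, hw⟩) hs.2
    | one =>
      intro hw
      have : qMat c ⟨1, hw⟩ = 1 := h.qMat_eq_one G.one_mem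
      rw [this]; simp
    | mul a b ha hb iha ihb =>
      intro hw
      have : qMat c ⟨a * b, hw⟩ = qMat c ⟨a, hsub ha⟩ * qMat c ⟨b, hsub hb⟩ :=
        h.rep.map_mul ⟨a, hsub ha⟩ ⟨b, hsub hb⟩
      rw [this, Matrix.det_mul, iha, ihb, Units.val_mul, Matrix.det_mul]
    | inv a ha iha =>
      intro hw
      have h1 : qMat c ⟨a⁻¹, hw⟩ * qMat c ⟨a, hsub ha⟩ = 1 := by
        refine (h.rep.map_mul ⟨a⁻¹, hw⟩ ⟨a, hsub ha⟩).symm.trans ?_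
        rw [show (⟨a⁻¹, hw⟩ : ↥Wt) * ⟨a, hsub ha⟩ = 1 from Subtype.ext (inv_mul_cancel a), map_one]
      have h2 := congrArg Matrix.det h1
      rw [Matrix.det_mul, iha, Matrix.det_one] at h2
      have h3 :
          (↑(a⁻¹) : Matrix (Fin n) (Fin n) k).det * (a : Matrix (Fin n) (Fin n) k).det = 1 := by
        rw [← Matrix.det_mul, ← Units.val_mul, inv_mul_cancel, Units.val_one, Matrix.det_one]
      exact mul_right_cancel₀ (right_ne_zero_of_mul_eq_one h3) (h2.trans h3.symm)
  rw [← hdet g (h.le hg), h.qMat_eq_one hg, Matrix.det_one]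

end Setup

/-! ### The subgroup generated by double reflections -/

theorem finrank_fixK_conj {n : ℕ} (w g : Matrix.GeneralLinearGroup (Fin n) k) :
    Module.finrank k (fixK ((w * g * w⁻¹ : Matrix.GeneralLinearGroup (Fin n) k) :
      Matrix (Fin n) (Fin n) k)) =
    Module.finrank k (fixK (g : Matrix (Fin n) (Fin n) k)) := by
  have hle : ∀ w g : Matrix.GeneralLinearGroup (Fin n) k,
      Module.finrank k (fixK (g : Matrix (Fin n) (Fin n) k)) ≤
      Module.finrank k (fixK ((w * g * w⁻¹ : Matrix.GeneralLinearGroup (Fin n) k) :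
        Matrix (Fin n) (Fin n) k)) := by
    intro w g
    have hinj : LinearMap.ker (Matrix.toLin' (w : Matrix (Fin n) (Fin n) k)) = ⊥ := by
      rw [LinearMap.ker_eq_bot]
      intro x y hxy
      have := congrArg (Matrix.mulVec (↑(w⁻¹) : Matrix (Fin n) (Fin n) k)) hxy
      rwa [Matrix.toLin'_apply, Matrix.toLin'_apply, Matrix.mulVec_mulVec, Matrix.mulVec_mulVec,
        ← Units.val_mul, inv_mul_cancel, Units.val_one, Matrix.one_mulVec,
        Matrix.one_mulVec] at this
    rw [← finrank_map_of_disjoint (Matrix.toLin' (w : Matrix (Fin n) (Fin n) k)) (fixK _)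
      (by rw [hinj]; exact disjoint_bot_left)]
    refine Submodule.finrank_mono ?_
    rintro _ ⟨x, hx, rfl⟩
    rw [SetLike.mem_coe, mem_fixK] at hx
    rw [mem_fixK, Matrix.toLin'_apply, Matrix.mulVec_mulVec, ← Units.val_mul,
      inv_mul_cancel_right, Units.val_mul, ← Matrix.mulVec_mulVec, hx]
  refine le_antisymm ?_ (hle w g)
  have := hle w⁻¹ (w * g * w⁻¹)
  rwa [inv_inv, show w⁻¹ * (w * g * w⁻¹) * w = g by group] at this

theorem finrank_fixK_inf {n : ℕ} (A B : Matrix (Fin n) (Fin n) k) :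
    Module.finrank k (fixK A) + Module.finrank k (fixK B) ≤
      Module.finrank k (fixK A ⊓ fixK B : Submodule k (Fin n → k)) + n := by
  have h1 := Submodule.finrank_sup_add_finrank_inf_eq (fixK A) (fixK B)
  have h2 := Submodule.finrank_le (fixK A ⊔ fixK B)
  rw [Module.finrank_fin_fun] at h2
  omega

section Setup

variable {n m : ℕ} {Wt G : Subgroup (Matrix.GeneralLinearGroup (Fin n) k)}
  {p : Fin m → MvPolynomial (Fin n) k} {d : Fin m → ℕ} {c : ↥Wt → Fin m → Fin m → k}

/-- The subgroup generated by the double reflections of `G`. -/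
def doubleSub (G : Subgroup (Matrix.GeneralLinearGroup (Fin n) k)) :
    Subgroup (Matrix.GeneralLinearGroup (Fin n) k) :=
  Subgroup.closure {g | g ∈ G ∧ IsDoubleReflection ((g : Matrix (Fin n) (Fin n) k))}

theorem doubleSub_le : doubleSub G ≤ G := by
  rw [doubleSub, Subgroup.closure_le]
  exact fun g hg => hg.1

theorem QuotSetup.conj_mem_doubleSub (h : QuotSetup Wt G p d c)
    {w g : Matrix.GeneralLinearGroup (Fin n) k} (hw : w ∈ Wt) (hg : g ∈ doubleSub G) :
    w * g * w⁻¹ ∈ doubleSub G := by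
  rw [doubleSub] at hg
  induction hg using Subgroup.closure_induction with
  | mem g hg =>
    refine Subgroup.subset_closure ⟨h.normal w hw g hg.1,
      isOfFinOrder_coe h.finiteG (h.normal w hw g hg.1), ?_⟩
    exact (congrArg (· + 2) (finrank_fixK_conj w g)).trans hg.2.2
  | one => simp [one_mem]
  | mul a b _ _ ha hb =>
    rw [show w * (a * b) * w⁻¹ = (w * a * w⁻¹) * (w * b * w⁻¹) by group]
    exact mul_mem ha hb
  | inv a _ ha =>
    rw [show w * a⁻¹ * w⁻¹ = (w * a * w⁻¹)⁻¹ by group]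
    exact inv_mem ha

theorem QuotSetup.mem_doubleSub (h : QuotSetup Wt G p d c)
    (hnorefl : ∀ g ∈ G, ¬ IsReflection ((g : Matrix (Fin n) (Fin n) k)))
    {g : Matrix.GeneralLinearGroup (Fin n) k} (hg : g ∈ G)
    (hfix : n ≤ Module.finrank k (fixK (g : Matrix (Fin n) (Fin n) k)) + 2) :
    g ∈ doubleSub G := by
  by_cases hg1 : g = 1
  · rw [hg1]; exact one_mem _
  · exact Subgroup.subset_closure ⟨hg, isOfFinOrder_coe h.finiteG hg,
      le_antisymm (h.finrank_fixK_le hnorefl hg hg1) hfix⟩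

/-- The group `G` is central in `Wt` modulo the subgroup generated by double reflections. -/
theorem QuotSetup.commutator_mem (h : QuotSetup Wt G p d c)
    (hnorefl : ∀ g ∈ G, ¬ IsReflection ((g : Matrix (Fin n) (Fin n) k)))
    {g w : Matrix.GeneralLinearGroup (Fin n) k} (hg : g ∈ G) (hw : w ∈ Wt) :
    g * w * g⁻¹ * w⁻¹ ∈ doubleSub G := by
  have hsub : ∀ {w}, w ∈ Subgroup.closure
      {g | g ∈ Wt ∧ IsReflection ((g : Matrix (Fin n) (Fin n) k))} → w ∈ Wt :=
    fun hw => by rw [← h.reflGroup]; exact hw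
  rw [← h.reflGroup] at hw
  induction hw using Subgroup.closure_induction with
  | mem s hs =>
    have hmem : g * s * g⁻¹ * s⁻¹ ∈ G := by
      rw [show g * s * g⁻¹ * s⁻¹ = g * (s * g⁻¹ * s⁻¹) by group]
      exact mul_mem hg (h.normal s hs.1 _ (inv_mem hg))
    refine h.mem_doubleSub hnorefl hmem ?_
    have h1 := finrank_fixK_conj g s
    have h2 := finrank_fixK_inf ((g * s * g⁻¹ : Matrix.GeneralLinearGroup (Fin n) k) :
      Matrix (Fin n) (Fin n) k) (s : Matrix (Fin n) (Fin n) k)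
    have h3 : Module.finrank k (fixK (s : Matrix (Fin n) (Fin n) k)) + 1 = n := hs.2.2
    have h4 : fixK ((g * s * g⁻¹ : Matrix.GeneralLinearGroup (Fin n) k) :
      Matrix (Fin n) (Fin n) k) ⊓ fixK (s : Matrix (Fin n) (Fin n) k) ≤
      fixK ((g * s * g⁻¹ * s⁻¹ : Matrix.GeneralLinearGroup (Fin n) k) :
        Matrix (Fin n) (Fin n) k) := by
      rintro x ⟨hx1, hx2⟩
      rw [SetLike.mem_coe, mem_fixK] at hx1 hx2
      rw [mem_fixK, Units.val_mul, ← Matrix.mulVec_mulVec]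
      have : Matrix.mulVec (↑(s⁻¹) : Matrix (Fin n) (Fin n) k) x = x := by
        conv_lhs => rw [← hx2]
        rw [Matrix.mulVec_mulVec, ← Units.val_mul, inv_mul_cancel, Units.val_one, Matrix.one_mulVec]
      rw [this, hx1]
    have h5 := Submodule.finrank_mono h4
    omega
  | one => simp [one_mem]
  | mul a b ha hb iha ihb =>
    rw [show g * (a * b) * g⁻¹ * (a * b)⁻¹ =
      (g * a * g⁻¹ * a⁻¹) * (a * (g * b * g⁻¹ * b⁻¹) * a⁻¹) by group]
    exact mul_mem iha (h.conj_mem_doubleSub (hsub ha) ihb)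
  | inv a ha iha =>
    rw [show g * a⁻¹ * g⁻¹ * a⁻¹⁻¹ = a⁻¹ * (g * a * g⁻¹ * a⁻¹)⁻¹ * a⁻¹⁻¹ by group]
    exact h.conj_mem_doubleSub (inv_mem (hsub ha)) (inv_mem iha)

/-- If `G` is not generated by double reflections then it has a nontrivial character which is
trivial on all elements whose fixed space has codimension at most `2`. -/
theorem QuotSetup.exists_character (h : QuotSetup Wt G p d c)
    (hnorefl : ∀ g ∈ G, ¬ IsReflection ((g : Matrix (Fin n) (Fin n) k)))
    (K : Type) [Field K] [CharZero K] [IsAlgClosed K] (hne : doubleSub G ≠ G) :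
    ∃ χ : ↥G →* Kˣ, χ ≠ 1 ∧ ∀ g : ↥G, χ g ≠ 1 →
      Module.finrank k (fixK ((g : Matrix.GeneralLinearGroup (Fin n) k) :
        Matrix (Fin n) (Fin n) k)) + 3 ≤ n := by
  have : Finite ↥G := h.finiteG
  obtain ⟨g₀, hg₀, hg₀'⟩ := SetLike.exists_of_lt (lt_of_le_of_ne doubleSub_le hne)
  set N : Subgroup ↥G := (doubleSub G).subgroupOf G with hN
  have hnormal : N.Normal := ⟨fun a ha g => h.conj_mem_doubleSub (h.le g.2) ha⟩
  let : CommGroup (↥G ⧸ N) :=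
    { (inferInstance : Group (↥G ⧸ N)) with
      mul_comm := by
        rintro ⟨a⟩ ⟨b⟩
        refine QuotientGroup.eq.mpr ?_
        have := h.commutator_mem hnorefl (inv_mem b.2) (h.le (inv_mem a.2))
        simpa [hN, Subgroup.mem_subgroupOf, mul_assoc] using this }
  have hne1 : (QuotientGroup.mk ⟨g₀, hg₀⟩ : ↥G ⧸ N) ≠ 1 := fun hh =>
    hg₀' (Subgroup.mem_subgroupOf.mp ((QuotientGroup.eq_one_iff _).mp hh))
  have : NeZero ((Monoid.exponent (↥G ⧸ N) : ℕ) : K) :=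
    ⟨by exact_mod_cast Monoid.exponent_ne_zero_of_finite⟩
  obtain ⟨φ, hφ⟩ := CommGroup.exists_apply_ne_one_of_hasEnoughRootsOfUnity (↥G ⧸ N) K hne1
  refine ⟨φ.comp (QuotientGroup.mk' N), fun hh => hφ ?_, fun g hg => ?_⟩
  · exact congrArg (fun ψ : ↥G →* Kˣ => ψ ⟨g₀, hg₀⟩) hh
  · by_contra! hlt
    refine hg ?_
    have hgN : g ∈ N := Subgroup.mem_subgroupOf.mpr
      (h.mem_doubleSub hnorefl g.2 (by omega))
    rw [MonoidHom.comp_apply, QuotientGroup.mk'_apply, (QuotientGroup.eq_one_iff g).mpr hgN,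
      map_one]

end Setup

/-! ### Quasi-regular families -/

/-- A family `f` is quasi-regular: a homogeneous form of degree `J` in `f` which lies in the power
`J + 1` of the ideal generated by `f` has all its coefficients in this ideal. -/
def QuasiReg {A κ : Type} [CommRing A] (f : κ → A) : Prop :=
  ∀ (J : ℕ) (P : MvPolynomial κ A), P.IsHomogeneous J →
    eval f P ∈ Ideal.span (Set.range f) ^ (J + 1) → ∀ b, coeff b P ∈ Ideal.span (Set.range f)

section Quasi

variable {A κ : Type} [CommRing A]

theorem mem_pow_iff_exists_form (f : κ → A) (J : ℕ) (x : A) :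
    x ∈ Ideal.span (Set.range f) ^ J ↔
      ∃ P : MvPolynomial κ A, P.IsHomogeneous J ∧ eval f P = x :=
  Ideal.mem_span_pow_iff_exists_isHomogeneous ..

theorem QuasiReg.mem_of_mul_mem {f : κ → A} (hf : QuasiReg f)
    (hI : (Ideal.span (Set.range f)).IsPrime) {a b : A} (ha : a ∉ Ideal.span (Set.range f))
    {J : ℕ} (hab : a * b ∈ Ideal.span (Set.range f) ^ J) : b ∈ Ideal.span (Set.range f) ^ J := by
  suffices h : ∀ j ≤ J, b ∈ Ideal.span (Set.range f) ^ j from h J le_rfl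
  intro j
  induction j with
  | zero => simp
  | succ j ih =>
    intro hj
    obtain ⟨P, hP, rfl⟩ := (mem_pow_iff_exists_form f j b).mp (ih (by lia))
    have h1 : eval f (C a * P) ∈ Ideal.span (Set.range f) ^ (j + 1) := by
      rw [map_mul, eval_C]
      exact Ideal.pow_le_pow_right hj hab
    have h2 := hf j (C a * P) (by simpa using (isHomogeneous_C _ a).mul hP) h1
    rw [eval_eq, pow_succ']
    refine Ideal.sum_mem _ fun d hd => Ideal.mul_mem_mul ?_ ?_
    · have := h2 d
      rw [coeff_C_mul] at this
      exact (hI.mem_or_mem this).resolve_left ha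
    · have : d.degree = j := by
        rw [← hP (mem_support_iff.mp hd)]; rw [Finsupp.degree_eq_weight_one]; rfl
      rw [← this, Finsupp.degree_apply, ← Finset.prod_pow_eq_pow_sum]
      exact Ideal.prod_mem_prod fun i _ =>
        Ideal.pow_mem_pow (Ideal.subset_span (Set.mem_range_self i)) _

variable [Algebra k A]

theorem derivation_mem_pow (D : Derivation k A A) (I : Ideal A) {J : ℕ} {x : A}
    (hx : x ∈ I ^ (J + 1)) : D x ∈ I ^ J := by
  induction J generalizing x with
  | zero => simp
  | succ J ih =>
    rw [pow_succ] at hx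
    refine Submodule.mul_induction_on hx (fun a ha b hb => ?_) fun a b ha hb => ?_
    · rw [Derivation.leibniz, smul_eq_mul, smul_eq_mul]
      refine Ideal.add_mem _ (Ideal.mul_mem_right _ _ ha) ?_
      rw [pow_succ']
      exact Ideal.mul_mem_mul hb (ih ha)
    · rw [map_add]; exact Ideal.add_mem _ ha hb

theorem derivation_aeval [Fintype κ] [DecidableEq κ] (D : Derivation k A A) (f : κ → A)
    (l : κ) (Δ : A)
    (hD : ∀ l', D (f l') = if l = l' then Δ else 0) (Q : MvPolynomial κ k) :
    D (aeval f Q) = Δ * aeval f (pderiv l Q) := by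
  induction Q using MvPolynomial.induction_on with
  | C a => simp
  | add p q hp hq => simp only [map_add, hp, hq, mul_add]
  | mul_X p i hp =>
    rw [map_mul, Derivation.leibniz, aeval_X, hp, hD, Derivation.leibniz, pderiv_X, map_add]
    by_cases h : l = i
    · subst h; simp; ring
    · simp [h, Ne.symm h]; ring

theorem derivation_eval_form [Fintype κ] [DecidableEq κ] (D : Derivation k A A) (f : κ → A) (l : κ)
    (Δ : A) (hD : ∀ l', D (f l') = if l = l' then Δ else 0) {J : ℕ} {P : MvPolynomial κ A}
    (hP : P.IsHomogeneous J) :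
    D (eval f P) - Δ * eval f (pderiv l P) ∈ Ideal.span (Set.range f) ^ J := by
  have key : ∀ (d : κ →₀ ℕ) (a : A), D (eval f (monomial d a)) =
      D a * eval f (monomial d 1) + Δ * eval f (pderiv l (monomial d a)) := by
    intro d a
    have h1 : eval f (monomial d (1 : A)) = aeval f (monomial d (1 : k)) := by
      simp [eval_monomial, aeval_monomial]
    have h2 : monomial d a = C a * monomial d (1 : A) := by simp [C_mul_monomial]
    have h3 : aeval f (pderiv l (monomial d (1 : k))) = eval f (pderiv l (monomial d (1 : A))) := by
      simp [pderiv_monomial, eval_monomial, aeval_monomial]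
    rw [h2, map_mul, eval_C, Derivation.leibniz, h1, derivation_aeval D f l Δ hD, pderiv_C_mul,
      map_mul, eval_C, h3, smul_eq_mul, smul_eq_mul]
    ring
  have hsum : D (eval f P) - Δ * eval f (pderiv l P) =
      ∑ d ∈ P.support, D (coeff d P) * eval f (monomial d 1) := by
    conv_lhs => rw [P.as_sum]
    simp only [map_sum, key, Finset.mul_sum, Finset.sum_add_distrib]
    ring
  rw [hsum]
  refine Ideal.sum_mem _ fun d hd => Ideal.mul_mem_left _ _ ?_
  refine (mem_pow_iff_exists_form f J _).mpr ⟨_, isHomogeneous_monomial _ ?_, rfl⟩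
  rw [← hP (mem_support_iff.mp hd)]; rw [Finsupp.degree_eq_weight_one]; rfl

theorem quasiReg_of_derivations [CharZero k] [Fintype κ] [DecidableEq κ] (f : κ → A)
    (hI : (Ideal.span (Set.range f)).IsPrime) (D : κ → Derivation k A A) (Δ : A)
    (hΔ : Δ ∉ Ideal.span (Set.range f)) (hD : ∀ l l', D l (f l') = if l = l' then Δ else 0) :
    QuasiReg f := by
  intro J
  induction J with
  | zero =>
    intro P hP h b
    have hPC : P = C (coeff 0 P) := by
      rw [← MvPolynomial.totalDegree_eq_zero_iff_eq_C]
      exact Nat.le_zero.mp hP.totalDegree_le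
    rw [hPC] at h ⊢
    rw [coeff_C]
    split_ifs
    · simpa using h
    · simp
  | succ J ih =>
    intro P hP h b
    by_cases hPb : coeff b P = 0
    · rw [hPb]; simp
    have hdeg : b.degree = J + 1 := by
      rw [← hP hPb]; rw [Finsupp.degree_eq_weight_one]; rfl
    have hb0 : b ≠ 0 := by rintro rfl; simp at hdeg
    obtain ⟨l, hl⟩ := Finsupp.ne_iff.mp hb0
    have h1 : Δ * eval f (pderiv l P) ∈ Ideal.span (Set.range f) ^ (J + 1) := by
      have := Ideal.sub_mem _ (derivation_mem_pow (D l) _ h)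
        (derivation_eval_form (D l) f l Δ (hD l) hP)
      simpa using this
    have h2 := ih (C Δ * pderiv l P)
      (by simpa using (isHomogeneous_C _ Δ).mul (hP.pderiv (i := l))) (by simpa using h1)
      (b - Finsupp.single l 1)
    rw [coeff_C_mul, coeff_pderiv] at h2
    have h3 := (hI.mem_or_mem h2).resolve_left hΔ
    have hle : Finsupp.single l 1 ≤ b := by
      simpa [Finsupp.single_le_iff, Nat.one_le_iff_ne_zero] using hl
    rw [tsub_add_cancel_of_le hle] at h3
    refine (hI.mem_or_mem h3).resolve_right fun h4 => hI.ne_top ?_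
    rw [Ideal.eq_top_iff_one]
    have h5 : algebraMap k A ((((b - Finsupp.single l 1 : κ →₀ ℕ) l : ℕ) : k) + 1)⁻¹ *
        ((((b - Finsupp.single l 1 : κ →₀ ℕ) l : ℕ) : A) + 1) ∈ Ideal.span (Set.range f) :=
      Ideal.mul_mem_left _ _ (by simpa using h4)
    rwa [← map_natCast (algebraMap k A), ← map_one (algebraMap k A), ← map_add, ← map_mul,
      inv_mul_cancel₀ (Nat.cast_add_one_ne_zero _), map_one] at h5

end Quasi

/-! ### Complete intersections -/

section CI

variable {n m : ℕ} {G : Subgroup (Matrix.GeneralLinearGroup (Fin n) k)}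
  {p : Fin m → MvPolynomial (Fin n) k}

theorem exists_trivStab [CharZero k] [Finite G] : ∃ x, TrivStab G x := by
  obtain ⟨x, hx⟩ := exists_forall_notMem (k := k) (ι := {g : G // g ≠ 1})
    (p := fun g => fixK ((g.1 : Matrix.GeneralLinearGroup (Fin n) k) :
      Matrix (Fin n) (Fin n) k)) fun g => by
    rw [Ne, fixK_eq_top, Units.val_eq_one]
    exact fun h => g.2 (Subtype.ext h)
  refine ⟨x, fun g hg hgx => ?_⟩
  by_contra hg1
  exact hx ⟨⟨g, hg⟩, fun h => hg1 (congrArg Subtype.val h)⟩ (mem_fixK.mpr hgx)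

theorem isPrime_relIdeal : (relIdeal p).IsPrime := by
  rw [relIdeal]
  exact RingHom.ker_isPrime _

theorem quasiReg_relations [CharZero k] [Fintype G]
    (hgen : Algebra.adjoin k (Set.range p) = invariants G)
    {s : Finset (MvPolynomial (Fin m) k)} (hcard : s.card = m - n)
    (hs : Ideal.span (s : Set (MvPolynomial (Fin m) k)) = relIdeal p) :
    QuasiReg (fun f : s => f.1) := by
  classical
  have hspan : Ideal.span (Set.range fun f : s => f.1) = relIdeal p := by
    rw [← hs]; congr 1; ext; simp
  obtain ⟨x, hx⟩ := exists_trivStab (G := G)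
  have hinj := dp_injective hgen hx
  have hnm : n ≤ m := by
    simpa using LinearMap.finrank_le_finrank_of_injective hinj
  have heval : ∀ f ∈ relIdeal p, eval (pMap p x) f = 0 := by
    intro f hf
    rw [← eval_aeval_pMap]
    have : aeval p f = 0 := hf
    rw [this, map_zero]
  let T : (Fin m → k) →ₗ[k] (s → k) := dp (fun f : s => f.1) (pMap p x)
  have hT : ∀ v l, T v l = eval (pMap p x) (dirD v l.1) := fun v l => rfl
  have hker : LinearMap.ker T ≤ LinearMap.range (dp p x) := by
    intro v hv
    refine mem_range_dp hgen hx fun f hf => ?_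
    rw [← hs] at hf
    have hsub : ∀ f ∈ Ideal.span (s : Set (MvPolynomial (Fin m) k)), f ∈ relIdeal p :=
      fun f hf => hs ▸ hf
    induction hf using Submodule.span_induction with
    | mem f hf => rw [← hT v ⟨f, hf⟩]; rw [LinearMap.mem_ker.mp hv]; rfl
    | zero => simp
    | add f g _ _ hf hg => rw [map_add, map_add, hf, hg, add_zero]
    | smul a f hf' hf =>
      rw [smul_eq_mul, Derivation.leibniz, smul_eq_mul, smul_eq_mul, map_add, map_mul, map_mul, hf,
        heval f (hsub f hf')]
      simp
  have hsurj : Function.Surjective T := by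
    rw [← LinearMap.range_eq_top]
    apply Submodule.eq_top_of_finrank_eq
    have h1 := LinearMap.finrank_range_add_finrank_ker T
    have h2 := Submodule.finrank_mono hker
    have h3 := LinearMap.finrank_range_of_inj hinj
    have h4 := Submodule.finrank_le (LinearMap.range T)
    simp only [Module.finrank_fintype_fun_eq_card, Fintype.card_coe, Fintype.card_fin] at *
    lia
  choose v hv using fun l : s => hsurj (Pi.single l 1)
  let N : Matrix s s (MvPolynomial (Fin m) k) := Matrix.of fun l l' => dirD (v l) l'.1
  have hN : N.map (eval (pMap p x)) = 1 := by
    ext l l'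
    have := congrFun (hv l) l'
    rw [hT] at this
    rw [Matrix.map_apply, show N l l' = dirD (v l) l'.1 from rfl, this, Matrix.one_apply,
      Pi.single_apply]
    simp [eq_comm]
  refine quasiReg_of_derivations (k := k) _ (hspan ▸ isPrime_relIdeal)
    (fun l => ∑ j, N.adjugate l j • dirD (v j)) N.det (fun h => ?_) fun l l' => ?_
  · rw [hspan] at h
    have h1 := heval _ h
    rw [RingHom.map_det, RingHom.mapMatrix_apply, hN, Matrix.det_one] at h1
    exact one_ne_zero h1
  · have h1 := congrFun (congrFun (Matrix.adjugate_mul N) l) l'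
    rw [Matrix.mul_apply, Matrix.smul_apply, Matrix.one_apply, smul_eq_mul, mul_ite, mul_one,
      mul_zero] at h1
    rw [← h1]
    have h2 : ∀ t : Finset s, (∑ j ∈ t, N.adjugate l j • dirD (v j)) l'.1 =
        ∑ j ∈ t, N.adjugate l j * N j l' := fun t => by
      induction t using Finset.induction_on with
      | empty => simp
      | insert a t ha ih =>
        rw [Finset.sum_insert ha, Finset.sum_insert ha, Derivation.add_apply, ih]
        rfl
    exact h2 _

end CI

/-! ### Ideals generated by linear forms -/

/-- The linear form with given coefficients. -/
def lin {n : ℕ} : (Fin n → k) →ₗ[k] MvPolynomial (Fin n) k where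
  toFun w := ∑ j, w j • X j
  map_add' v w := by simp [add_smul, Finset.sum_add_distrib]
  map_smul' c w := by simp [Finset.smul_sum, smul_smul]

section Lin

variable {n : ℕ}

theorem lin_apply (w : Fin n → k) : lin w = ∑ j, w j • (X j : MvPolynomial (Fin n) k) := rfl

theorem lin_single (j : Fin n) : lin (Pi.single j 1) = (X j : MvPolynomial (Fin n) k) := by
  simp [lin_apply, Pi.single_apply]

theorem eval_lin (w x : Fin n → k) : eval x (lin w) = ∑ j, w j * x j := by
  simp [lin_apply, smul_eval]

theorem lin_injective : Function.Injective (lin : (Fin n → k) →ₗ[k] MvPolynomial (Fin n) k) := by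
  rw [← LinearMap.ker_eq_bot, LinearMap.ker_eq_bot']
  intro w hw
  ext j
  have := congrArg (eval (Pi.single j 1)) hw
  rw [eval_lin] at this
  simpa [Pi.single_apply] using this

/-- The ideal generated by the linear forms with coefficients in a set. -/
theorem span_lin (S : Set (Fin n → k)) : (Ideal.span (lin '' S)).IsPrime ∧
    ∀ w, lin w ∈ Ideal.span (lin '' S) → w ∈ Submodule.span k S := by
  set U := Submodule.span k S with hU
  obtain ⟨U', hU'⟩ := U.exists_isCompl
  have hlin : ∀ w ∈ U, lin w ∈ Ideal.span (lin '' S) := by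
    intro w hw
    induction hw using Submodule.span_induction with
    | mem w hw => exact Ideal.subset_span ⟨w, hw, rfl⟩
    | zero => simp
    | add v w _ _ hv hw => rw [map_add]; exact Ideal.add_mem _ hv hw
    | smul c w _ hw => rw [map_smul, smul_eq_C_mul]; exact Ideal.mul_mem_left _ _ hw
  let P : (Fin n → k) →ₗ[k] (Fin n → k) := U'.subtype ∘ₗ U'.projectionOnto U hU'.symm
  have hP : ∀ w, P w = 0 ↔ w ∈ U := by
    intro w
    have : P w = 0 ↔ U'.projectionOnto U hU'.symm w = 0 := by simp [P]
    rw [this, Submodule.projectionOnto_apply_eq_zero_iff]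
  have hPP : ∀ w, w - P w ∈ U := by
    intro w
    have h1 : P (P w) = P w :=
      congrArg Subtype.val (Submodule.projectionOnto_apply_left hU'.symm _)
    rw [← hP, map_sub, h1, sub_self]
  let ρ : MvPolynomial (Fin n) k →ₐ[k] MvPolynomial (Fin n) k :=
    aeval fun j => lin (P (Pi.single j 1))
  have hρ : ∀ w, ρ (lin w) = lin (P w) := by
    intro w
    conv_rhs => rw [pi_eq_sum_univ' w]
    rw [lin_apply, map_sum, map_sum, map_sum]
    refine Finset.sum_congr rfl fun j _ => ?_
    rw [map_smul, map_smul, map_smul]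
    congr 1
    exact aeval_X _ _
  have hmod : ∀ f, f - ρ f ∈ Ideal.span (lin '' S) := by
    intro f
    induction f using MvPolynomial.induction_on with
    | C a => rw [← algebraMap_eq, AlgHom.commutes, sub_self]; exact zero_mem _
    | add p q hp hq =>
      rw [map_add, add_sub_add_comm]; exact Ideal.add_mem _ hp hq
    | mul_X p j hp =>
      have h1 : X j - ρ (X j) ∈ Ideal.span (lin '' S) := by
        rw [← lin_single, hρ, ← map_sub]; exact hlin _ (hPP _)
      have : p * X j - ρ (p * X j) = (p - ρ p) * X j + ρ p * (X j - ρ (X j)) := by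
        rw [map_mul]; ring
      rw [this]
      exact Ideal.add_mem _ (Ideal.mul_mem_right _ _ hp) (Ideal.mul_mem_left _ _ h1)
  have hker : Ideal.span (lin '' S) = RingHom.ker ρ := by
    apply le_antisymm
    · rw [Ideal.span_le]
      rintro _ ⟨w, hw, rfl⟩
      change ρ (lin w) = 0
      rw [hρ, (hP w).mpr (Submodule.subset_span hw), map_zero]
    · intro f hf
      have hf : ρ f = 0 := hf
      simpa [hf] using hmod f
  refine ⟨hker ▸ RingHom.ker_isPrime _, fun w hw => ?_⟩
  rw [hker] at hw
  have hw : ρ (lin w) = 0 := hw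
  rw [hρ] at hw
  exact (hP w).mp (lin_injective (hw.trans (map_zero _).symm))

theorem prime_lin {w : Fin n → k} (hw : w ≠ 0) : Prime (lin w) := by
  rw [← Ideal.span_singleton_prime (fun h => hw (lin_injective (h.trans (map_zero _).symm))),
    ← Set.image_singleton]
  exact (span_lin _).1

theorem isRelPrime_lin {v w : Fin n → k} (hv : v ≠ 0) (hw : w ∉ Submodule.span k {v}) :
    IsRelPrime (lin v) (lin w) := by
  rw [(prime_lin hv).irreducible.isRelPrime_iff_not_dvd, ← Ideal.mem_span_singleton,
    ← Set.image_singleton]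
  exact fun h => hw ((span_lin _).2 _ h)

end Lin

/-! ### Regular sequences of length three -/

/-- `z` is a nonzerodivisor modulo the ideal `(x, y)`. -/
def Reg3 {B : Type} [CommRing B] (x y z : B) : Prop :=
  ∀ c, z * c ∈ Ideal.span {x, y} → c ∈ Ideal.span {x, y}

theorem Reg3.symm {B : Type} [CommRing B] {x y z : B} (h : Reg3 x y z) : Reg3 y x z := by
  unfold Reg3; rw [Set.pair_comm]; exact h

theorem reg3_lin {n : ℕ} {u v w : Fin n → k} (hw : w ∉ Submodule.span k {u, v}) :
    Reg3 (lin u) (lin v) (lin w) := by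
  intro c hc
  rw [← Set.image_pair] at hc ⊢
  exact ((span_lin _).1.mem_or_mem hc).resolve_left fun h => hw ((span_lin _).2 _ h)

section Reg

variable {B : Type} [CommRing B] [IsDomain B] [DecompositionMonoid B]

/-- The elements which are nonzerodivisors modulo `(x, y)`. -/
def reg3Submonoid (x y : B) : Submonoid B where
  carrier := {z | Reg3 x y z}
  one_mem' c hc := by simpa using hc
  mul_mem' ha hb c hc := hb _ (ha _ (by rwa [← mul_assoc]))

/-- The elements `x` prime to `y` and such that `z` is regular modulo `(x, y)`. -/
def relPrimeReg (y z : B) : Submonoid B where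
  carrier := {x | IsRelPrime x y ∧ Reg3 x y z}
  one_mem' := ⟨isRelPrime_one_left, fun c _ => by
    rw [(Ideal.eq_top_iff_one _).mpr (Ideal.subset_span (by simp))]; trivial⟩
  mul_mem' := by
    rintro x x' ⟨hx, hxz⟩ ⟨hx', hxz'⟩
    refine ⟨hx.mul_left hx', fun c hc => ?_⟩
    obtain ⟨a, b, hab⟩ := Ideal.mem_span_pair.mp hc
    obtain ⟨a₁, b₁, hc₁⟩ := Ideal.mem_span_pair.mp
      (hxz c (Ideal.mem_span_pair.mpr ⟨a * x', b, by rw [← hab]; ring⟩))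
    have h1 : y ∣ x * (z * a₁ - a * x') := ⟨b - z * b₁, by
      linear_combination z * hc₁ - hab⟩
    obtain ⟨e, he⟩ := hx.symm.dvd_of_dvd_mul_left h1
    obtain ⟨a₂, b₂, ha₂⟩ := Ideal.mem_span_pair.mp
      (hxz' a₁ (Ideal.mem_span_pair.mpr ⟨a, e, by linear_combination -he⟩))
    exact Ideal.mem_span_pair.mpr ⟨a₂, b₁ + x * b₂, by
      linear_combination hc₁ + x * ha₂⟩

end Reg

section Generic

variable {n : ℕ}

theorem comap_ne_top {M : Matrix (Fin n) (Fin n) k} (hM : Module.finrank k (fixK M) + 3 ≤ n)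
    {U : Submodule k (Fin n → k)} (hU : Module.finrank k U ≤ 2) :
    U.comap ((M - 1).transpose.mulVecLin) ≠ ⊤ := by
  intro h
  have h1 : LinearMap.range ((M - 1).transpose.mulVecLin) ≤ U := by
    rintro _ ⟨v, rfl⟩
    have : v ∈ U.comap ((M - 1).transpose.mulVecLin) := h ▸ trivial
    exact this
  have h2 := Submodule.finrank_mono h1
  have h3 : Module.finrank k (LinearMap.range ((M - 1).transpose.mulVecLin)) = (M - 1).rank := by
    rw [← Matrix.rank_transpose]; rfl
  have h4 := LinearMap.finrank_range_add_finrank_ker (M - 1).mulVecLin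
  have h5 : LinearMap.ker (M - 1).mulVecLin = fixK M := by
    ext x
    rw [mem_fixK, LinearMap.mem_ker, Matrix.mulVecLin_apply, Matrix.sub_mulVec, Matrix.one_mulVec,
      sub_eq_zero]
  rw [h5] at h4
  simp only [Module.finrank_fintype_fun_eq_card, Fintype.card_fin] at h4
  rw [Matrix.rank] at h3
  lia

theorem exists_regular_triple [CharZero k] {ι : Type} [Fintype ι]
    (M : ι → Matrix (Fin n) (Fin n) k) (hM : ∀ i, Module.finrank k (fixK (M i)) + 3 ≤ n) :
    ∃ s₀ s₁ s₂ : MvPolynomial (Fin n) k,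
      (∀ i x, (M i).mulVec x = x → eval x s₀ = 0 ∧ eval x s₁ = 0 ∧ eval x s₂ = 0) ∧
      s₀ ≠ 0 ∧ s₁ ≠ 0 ∧ s₂ ≠ 0 ∧
      ∀ N : ℕ, IsRelPrime (s₀ ^ N) (s₁ ^ N) ∧ Reg3 (s₀ ^ N) (s₁ ^ N) (s₂ ^ N) := by
  set T : ι → (Fin n → k) →ₗ[k] (Fin n → k) := fun i => (M i - 1).transpose.mulVecLin with hT
  obtain ⟨v₀, hv₀⟩ := exists_forall_notMem (p := fun i => (⊥ : Submodule k (Fin n → k)).comap (T i))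
    fun i => comap_ne_top (hM i) (by simp)
  obtain ⟨v₁, hv₁⟩ := exists_forall_notMem (ι := ι × ι)
    (p := fun i => (Submodule.span k {T i.1 v₀}).comap (T i.2))
    fun i => comap_ne_top (hM i.2) ((finrank_span_le_card _).trans (by simp))
  obtain ⟨v₂, hv₂⟩ := exists_forall_notMem (ι := ι × ι × ι)
    (p := fun i => (Submodule.span k {T i.1 v₀, T i.2.1 v₁}).comap (T i.2.2))
    fun i => comap_ne_top (hM i.2.2) (by
      classical
      refine (finrank_span_le_card _).trans ?_
      rw [Set.toFinset_insert, Set.toFinset_singleton]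
      exact Finset.card_le_two)
  have hv₀' : ∀ i, T i v₀ ≠ 0 := fun i h => hv₀ i (by simpa using h)
  have hv₁' : ∀ i j, T j v₁ ∉ Submodule.span k {T i v₀} := fun i j => hv₁ (i, j)
  have hv₂' : ∀ i j l, T l v₂ ∉ Submodule.span k {T i v₀, T j v₁} := fun i j l => hv₂ (i, j, l)
  have hv₁0 : ∀ i, T i v₁ ≠ 0 := fun i h => hv₁' i i (by rw [h]; exact zero_mem _)
  have hv₂0 : ∀ i, T i v₂ ≠ 0 := fun i h => hv₂' i i i (by rw [h]; exact zero_mem _)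
  have hev : ∀ i x v, (M i).mulVec x = x → eval x (lin (T i v)) = 0 := by
    intro i x v hx
    rw [eval_lin, hT]
    change dotProduct ((M i - 1).transpose.mulVec v) x = 0
    rw [Matrix.mulVec_transpose, ← Matrix.dotProduct_mulVec, Matrix.sub_mulVec, hx]
    simp
  have hprod : ∀ v x i, (M i).mulVec x = x → eval x (∏ i, lin (T i v)) = 0 := by
    intro v x i hx
    rw [map_prod]
    exact Finset.prod_eq_zero (Finset.mem_univ i) (hev i x v hx)
  have hne : ∀ v, (∀ i, T i v ≠ 0) → ∏ i, lin (T i v) ≠ 0 := fun v hv =>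
    Finset.prod_ne_zero_iff.mpr fun i _ => (prime_lin (hv i)).ne_zero
  refine ⟨∏ i, lin (T i v₀), ∏ i, lin (T i v₁), ∏ i, lin (T i v₂),
    fun i x hx => ⟨hprod _ x i hx, hprod _ x i hx, hprod _ x i hx⟩, hne _ hv₀', hne _ hv₁0,
    hne _ hv₂0, fun N => ?_⟩
  have h1 : ∀ i j, Reg3 (lin (T i v₀)) (lin (T j v₁)) ((∏ i, lin (T i v₂)) ^ N) := fun i j =>
    pow_mem (S := reg3Submonoid (lin (T i v₀)) (lin (T j v₁)))
      (prod_mem fun l _ => reg3_lin (hv₂' i j l)) N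
  have h2 : ∀ i j, lin (T i v₀) ∈ relPrimeReg (lin (T j v₁)) ((∏ i, lin (T i v₂)) ^ N) :=
    fun i j => ⟨isRelPrime_lin (hv₀' i) (hv₁' i j), h1 i j⟩
  have h3 : ∀ j, (∏ i, lin (T i v₀)) ^ N ∈
      relPrimeReg (lin (T j v₁)) ((∏ i, lin (T i v₂)) ^ N) :=
    fun j => pow_mem (prod_mem fun i _ => h2 i j) N
  have h4 : ∀ j, lin (T j v₁) ∈
      relPrimeReg ((∏ i, lin (T i v₀)) ^ N) ((∏ i, lin (T i v₂)) ^ N) :=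
    fun j => ⟨(h3 j).1.symm, (h3 j).2.symm⟩
  have h5 : (∏ i, lin (T i v₁)) ^ N ∈
      relPrimeReg ((∏ i, lin (T i v₀)) ^ N) ((∏ i, lin (T i v₂)) ^ N) :=
    pow_mem (prod_mem fun j _ => h4 j) N
  exact ⟨h5.1.symm, h5.2.symm⟩

end Generic

/-! ### Extension across subsets of codimension at least three -/

section Hartogs

variable {B F : Type} [CommRing B] [Field F] [Algebra B F]

/-- The subalgebra `B[1/u]` of the fraction field of `B`. -/
def locSub (F : Type) [Field F] [Algebra B F] (u : B) : Subalgebra B F where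
  carrier := {z | ∃ N : ℕ, ∃ b : B, algebraMap B F (u ^ N) * z = algebraMap B F b}
  mul_mem' := by
    rintro z w ⟨N, b, hb⟩ ⟨N', b', hb'⟩
    exact ⟨N + N', b * b', by rw [map_mul, ← hb, ← hb', pow_add, map_mul]; ring⟩
  add_mem' := by
    rintro z w ⟨N, b, hb⟩ ⟨N', b', hb'⟩
    exact ⟨N + N', u ^ N' * b + u ^ N * b', by
      rw [map_add, map_mul, map_mul, ← hb, ← hb', pow_add, map_mul]; ring⟩
  algebraMap_mem' b := ⟨0, b, by simp⟩

theorem mem_locSub {u : B} {z : F} : z ∈ locSub F u ↔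
    ∃ N : ℕ, ∃ b : B, algebraMap B F (u ^ N) * z = algebraMap B F b := Iff.rfl

theorem locSub_mul_left {u v : B} {z : F} (hz : z ∈ locSub F u) : z ∈ locSub F (u * v) := by
  obtain ⟨N, b, hb⟩ := hz
  exact ⟨N, v ^ N * b, by rw [map_mul, ← hb, mul_pow, map_mul]; ring⟩

theorem locSub_mul_right {u v : B} {z : F} (hz : z ∈ locSub F v) : z ∈ locSub F (u * v) := by
  rw [mul_comm]; exact locSub_mul_left hz

theorem inv_mem_locSub {u : B} (hu : algebraMap B F u ≠ 0) : (algebraMap B F u)⁻¹ ∈ locSub F u :=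
  ⟨1, 1, by rw [pow_one, map_one, mul_inv_cancel₀ hu]⟩

theorem exists_uniform {ι : Type} [Fintype ι] {v : ι → B} {z : ι → F}
    (h : ∀ i, z i ∈ locSub F (v i)) :
    ∃ N : ℕ, ∀ i, ∃ b : B, algebraMap B F (v i ^ N) * z i = algebraMap B F b := by
  choose N b hb using fun i => mem_locSub.mp (h i)
  refine ⟨∑ i, N i, fun i => ?_⟩
  obtain ⟨r, hr⟩ := Nat.exists_eq_add_of_le (Finset.single_le_sum (f := N)
    (fun _ _ => Nat.zero_le _) (Finset.mem_univ i))
  exact ⟨v i ^ r * b i, by rw [hr, map_mul, ← hb, pow_add, map_mul]; ring⟩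

/-- A family with common zero locus of codimension at least three, witnessed by a regular
sequence in the radical. -/
def DepthThree {ι : Type} (u : ι → B) : Prop :=
  ∃ s : Fin 3 → B, (∀ a, s a ∈ (Ideal.span (Set.range u)).radical) ∧ (∀ a, s a ≠ 0) ∧
    ∀ N : ℕ, IsRelPrime (s 0 ^ N) (s 1 ^ N) ∧ Reg3 (s 0 ^ N) (s 1 ^ N) (s 2 ^ N)

theorem exists_pow_mem {ι : Type} {u : ι → B} {s : Fin 3 → B}
    (hs : ∀ a, s a ∈ (Ideal.span (Set.range u)).radical) (N : ℕ) :
    ∃ M : ℕ, ∀ a, s a ^ M ∈ Ideal.span (Set.range fun i => u i ^ N) := by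
  have h : Ideal.span (Set.range u) ≤ (Ideal.span (Set.range fun i => u i ^ N)).radical := by
    rw [Ideal.span_le]
    rintro _ ⟨i, rfl⟩
    exact ⟨N, Ideal.subset_span ⟨i, rfl⟩⟩
  choose M hM using fun a => (Ideal.radical_le_radical_iff.mpr h) (hs a)
  refine ⟨∑ a, M a, fun a => ?_⟩
  exact Ideal.pow_mem_of_pow_mem _ (hM a) (Finset.single_le_sum (f := M)
    (fun _ _ => Nat.zero_le _) (Finset.mem_univ a))

variable [IsDomain B] [DecompositionMonoid B] [IsFractionRing B F]

theorem mem_of_isRelPrime {x y : B} (hx : x ≠ 0) (h : IsRelPrime x y) {z : F} {a b : B}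
    (ha : algebraMap B F x * z = algebraMap B F a) (hb : algebraMap B F y * z = algebraMap B F b) :
    ∃ c : B, algebraMap B F c = z := by
  have h1 : y * a = x * b := by
    apply IsFractionRing.injective B F
    rw [map_mul, map_mul, ← ha, ← hb]; ring
  obtain ⟨c, rfl⟩ := h.dvd_of_dvd_mul_left ⟨b, h1⟩
  refine ⟨c, ?_⟩
  have hx' : algebraMap B F x ≠ 0 := fun h0 => hx (IsFractionRing.injective B F (by simpa using h0))
  rw [map_mul] at ha
  exact (mul_left_cancel₀ hx' ha).symm

theorem DepthThree.mem_of_forall {ι : Type} [Fintype ι] {u : ι → B} (hu : DepthThree u) {z : F}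
    (hz : ∀ i, z ∈ locSub F (u i)) : ∃ b : B, algebraMap B F b = z := by
  obtain ⟨s, hs, hs0, hreg⟩ := hu
  obtain ⟨N, hN⟩ := exists_uniform (z := fun _ => z) hz
  choose b hb using hN
  obtain ⟨M, hM⟩ := exists_pow_mem hs N
  have key : ∀ a, ∃ x, algebraMap B F (s a ^ M) * z = algebraMap B F x := by
    intro a
    obtain ⟨c, hc⟩ := (Ideal.mem_span_range_iff_exists_fun).mp (hM a)
    refine ⟨∑ i, c i * b i, ?_⟩
    rw [← hc, map_sum, map_sum, Finset.sum_mul]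
    refine Finset.sum_congr rfl fun i _ => ?_
    rw [map_mul, map_mul, ← hb, mul_assoc]
  obtain ⟨x, hx⟩ := key 0
  obtain ⟨y, hy⟩ := key 1
  exact mem_of_isRelPrime (pow_ne_zero _ (hs0 0)) (hreg M).1 hx hy

/-- Vanishing of the first cohomology of the structure sheaf on the complement of a closed subset
of codimension at least three. -/
theorem DepthThree.exists_of_cocycle {ι : Type} [Fintype ι] {u : ι → B} (hu : DepthThree u)
    {z : ι → F} (hz : ∀ i j, z i - z j ∈ locSub F (u i * u j)) :
    ∃ d : F, ∀ i, d - z i ∈ locSub F (u i) := by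
  obtain ⟨s, hs, hs0, hreg⟩ := hu
  obtain ⟨N, hN⟩ := exists_uniform (ι := ι × ι) (v := fun i => u i.1 * u i.2)
    (z := fun i => z i.1 - z i.2) fun i => hz i.1 i.2
  have hN' : ∀ i j, ∃ b : B, algebraMap B F ((u i * u j) ^ N) * (z i - z j) = algebraMap B F b :=
    fun i j => hN (i, j)
  choose b hb using hN'
  obtain ⟨M, hM⟩ := exists_pow_mem hs N
  choose c hc using fun a => (Ideal.mem_span_range_iff_exists_fun).mp (hM a)
  set φ := algebraMap B F with hφ
  have hS : ∀ a, φ (s a ^ M) ≠ 0 := fun a h0 =>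
    pow_ne_zero M (hs0 a) (IsFractionRing.injective B F (h0.trans (map_zero _).symm))
  set z' : Fin 3 → F := fun a => (∑ i, φ (c a i * u i ^ N) * z i) / φ (s a ^ M) with hz'
  have hz'S : ∀ a, φ (s a ^ M) * z' a = ∑ i, φ (c a i * u i ^ N) * z i := fun a => by
    rw [hz']; exact mul_div_cancel₀ _ (hS a)
  have hSsum : ∀ a, φ (s a ^ M) = ∑ i, φ (c a i * u i ^ N) := fun a => by
    rw [← hc a, map_sum]
  have h1 : ∀ a j, φ (s a ^ M) * φ (u j ^ N) * (z' a - z j) = φ (∑ i, c a i * b i j) := by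
    intro a j
    have : φ (s a ^ M) * φ (u j ^ N) * (z' a - z j) =
        φ (u j ^ N) * (φ (s a ^ M) * z' a) - φ (u j ^ N) * (φ (s a ^ M) * z j) := by ring
    rw [this, hz'S, hSsum, Finset.sum_mul, Finset.mul_sum, Finset.mul_sum,
      ← Finset.sum_sub_distrib, map_sum]
    refine Finset.sum_congr rfl fun i _ => ?_
    rw [map_mul φ (c a i) (b i j), ← hb, mul_pow, map_mul, map_mul]
    ring
  have h2 : ∀ a a', φ (s a ^ M) * φ (s a' ^ M) * (z' a - z' a') =
      φ (∑ j, c a' j * ∑ i, c a i * b i j) := by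
    intro a a'
    have : φ (s a ^ M) * φ (s a' ^ M) * (z' a - z' a') =
        φ (s a ^ M) * (φ (s a' ^ M) * z' a - φ (s a' ^ M) * z' a') := by ring
    rw [this, hz'S, hSsum a', Finset.sum_mul, ← Finset.sum_sub_distrib, Finset.mul_sum, map_sum]
    refine Finset.sum_congr rfl fun j _ => ?_
    rw [map_mul φ (c a' j) (∑ i, c a i * b i j), ← h1, map_mul]
    ring
  set e : Fin 3 → Fin 3 → B := fun a a' => ∑ j, c a' j * ∑ i, c a i * b i j with he
  have h3 : s 2 ^ M * e 0 1 = s 1 ^ M * e 0 2 - s 0 ^ M * e 1 2 := by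
    apply IsFractionRing.injective B F
    rw [← hφ, map_sub, map_mul, map_mul, map_mul, ← h2, ← h2, ← h2]
    ring
  obtain ⟨x, y, hxy⟩ := Ideal.mem_span_pair.mp ((hreg M).2 (e 0 1)
    (Ideal.mem_span_pair.mpr ⟨-e 1 2, e 0 2, by rw [h3]; ring⟩))
  have h4 : φ (s 0 ^ M) * φ (s 1 ^ M) * (z' 0 - z' 1) =
      φ x * φ (s 0 ^ M) + φ y * φ (s 1 ^ M) := by
    rw [h2, ← map_mul, ← map_mul, ← map_add, hxy]
  refine ⟨z' 0 - φ y / φ (s 0 ^ M), fun j => ?_⟩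
  obtain ⟨w, hw⟩ := mem_of_isRelPrime (F := F) (x := s 0 ^ M) (y := s 1 ^ M)
    (z := φ (u j ^ N) * (z' 0 - φ y / φ (s 0 ^ M) - z j))
    (a := ∑ i, c 0 i * b i j - u j ^ N * y) (b := ∑ i, c 1 i * b i j + u j ^ N * x)
    (pow_ne_zero _ (hs0 0)) (hreg M).1 (by
      rw [← hφ, map_sub, ← h1, map_mul]
      have h0 := hS 0
      field_simp
      ring) (by
      rw [← hφ, map_add, ← h1, map_mul]
      have h5 : z' 0 - φ y / φ (s 0 ^ M) = z' 1 + φ x / φ (s 1 ^ M) := by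
        have h0 := hS 0
        have h1 := hS 1
        field_simp
        linear_combination h4
      rw [h5]
      have h1 := hS 1
      field_simp
      ring)
  exact ⟨N, w, hw.symm⟩

end Hartogs

/-! ### Lifting products of semi-invariants -/

section Solve

variable {B : Type} [CommRing B] [IsDomain B] [DecompositionMonoid B] [Algebra k B]

/-- The linearized equations for a lifting of the products `u l * u m ^ q` are solvable as soon as
the obstructions satisfy the compatibility `hκ`. -/
theorem exists_linear_solution [CharZero k] (F : Type) [Field F] [Algebra B F]
    [IsFractionRing B F] {ι : Type} [Fintype ι] {u : ι → B}
    (hu : DepthThree u) (hu0 : ∀ i, u i ≠ 0) (r : ℕ) (E : ι → ι → ι → B) (κ : ι → ι → B)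
    (hE : ∀ l i, E l i i = 0)
    (hκ : ∀ l m i, κ l m * (u i * u i ^ (r + 1)) ^ (r + 1)
      + ((r + 1 : ℕ) + 1) * (u l * u m ^ (r + 1)) ^ (r + 1) * E l m i
      - (u m * u m ^ (r + 1)) ^ (r + 1) * E l l i
      - (r + 1 : ℕ) * (u l * u l ^ (r + 1)) * (u m * u m ^ (r + 1)) ^ r * E m m i = 0) :
    ∃ δ : ι → ι → B, ∀ l m i,
      E l m i + (u m * u i ^ (r + 1)) ^ (r + 1) * δ l i
        + (r + 1 : ℕ) * (u l * u i ^ (r + 1)) * (u m * u i ^ (r + 1)) ^ r * δ m i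
        - (u i * u i ^ (r + 1)) ^ (r + 1) * δ l m
        - (r + 1 : ℕ) * (u l * u m ^ (r + 1)) * (u i * u i ^ (r + 1)) ^ r * δ i i = 0 := by
  set φ := algebraMap B F with hφ
  have hφinj : Function.Injective φ := IsFractionRing.injective B F
  have hunit : IsUnit (((r + 1 : ℕ) : B) + 1) := by
    have h1 : (((r + 1 : ℕ) : k) + 1) ≠ 0 := Nat.cast_add_one_ne_zero _
    have := (isUnit_iff_ne_zero.mpr h1).map (algebraMap k B)
    simpa using this
  obtain ⟨e, he⟩ := hunit.exists_right_inv
  obtain ⟨a, ha⟩ : ∃ a : ι → F, ∀ i, φ (u i) = a i := ⟨_, fun _ => rfl⟩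
  have ha0 : ∀ i, a i ≠ 0 := fun i h =>
    hu0 i (hφinj (((ha i).trans h).trans (map_zero _).symm))
  set t : F := φ (((r + 1 : ℕ) : B) + 1) with ht
  have ht' : t = (r : F) + 2 := by rw [ht]; simp; ring
  have het : φ e * t = 1 := by rw [ht, ← map_mul, mul_comm, he, map_one]
  have ht0 : t ≠ 0 := right_ne_zero_of_mul_eq_one het
  have htinv : t⁻¹ = φ e := by rw [eq_comm]; exact eq_inv_of_mul_eq_one_left het
  set c : ι → ι → F := fun l i =>
    φ (E l l i) * t⁻¹ * (a i)⁻¹ ^ ((r + 1) * (r + 2)) * (a l)⁻¹ ^ (r + 1) with hc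
  set lam : ι → ι → F := fun l m =>
    φ (κ l m) * t⁻¹ * (a l)⁻¹ ^ (r + 1) * (a m)⁻¹ ^ ((r + 1) * (r + 1)) with hlam
  have hcE : ∀ l i, φ (E l l i) = t * a i ^ ((r + 1) * (r + 2)) * a l ^ (r + 1) * c l i := by
    intro l i
    have h1 := ha0 i
    have h2 := ha0 l
    simp only [hc, inv_pow]
    field_simp
  have hlamκ : ∀ l m, φ (κ l m) = t * a l ^ (r + 1) * a m ^ ((r + 1) * (r + 1)) * lam l m := by
    intro l i
    have h1 := ha0 i
    have h2 := ha0 l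
    simp only [hlam, inv_pow]
    field_simp
  have hE1 : ∀ l m i, φ (E l m i) = a i ^ ((r + 1) * (r + 2)) *
      (a m ^ (r + 1) * c l i + (r + 1) * a l * a m ^ r * c m i - lam l m) := by
    intro l m i
    have h1 := congrArg φ (hκ l m i)
    simp only [map_add, map_sub, map_mul, map_pow, map_zero, map_natCast, map_one, hcE,
      hlamκ, ha] at h1
    have h2 : t * a l ^ (r + 1) * a m ^ ((r + 1) * (r + 1)) ≠ 0 :=
      mul_ne_zero (mul_ne_zero ht0 (pow_ne_zero _ (ha0 l))) (pow_ne_zero _ (ha0 m))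
    apply mul_left_cancel₀ h2
    push_cast at h1
    rw [ht'] at h1 ⊢
    linear_combination h1
  have hcii : ∀ i, c i i = 0 := by
    intro i
    simp only [hc, hE, map_zero, zero_mul]
  have hlami : ∀ l i, lam l i = a i ^ (r + 1) * c l i := by
    intro l i
    have h1 := hE1 l i i
    rw [hE, map_zero, hcii, eq_comm] at h1
    have := (mul_eq_zero.mp h1).resolve_left (pow_ne_zero _ (ha0 i))
    linear_combination -this
  have hmem : ∀ b i, φ b ∈ locSub F (u i) := fun b i => Subalgebra.algebraMap_mem _ b
  have hinv : ∀ i, (a i)⁻¹ ∈ locSub F (u i) := fun i => by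
    rw [← ha]; exact inv_mem_locSub (by rw [ha]; exact ha0 i)
  have hcmem : ∀ i j, c i j ∈ locSub F (u i * u j) := by
    intro i j
    rw [hc, htinv]
    refine mul_mem (mul_mem (mul_mem ?_ ?_) (pow_mem ?_ _)) (pow_mem ?_ _)
    · exact locSub_mul_left (hmem _ i)
    · exact locSub_mul_left (hmem _ i)
    · exact locSub_mul_right (hinv j)
    · exact locSub_mul_left (hinv i)
  have hcdiff : ∀ l i j, c l i - c l j ∈ locSub F (u i * u j) := by
    intro l i j
    have h1 := hE1 l i j
    rw [hlami] at h1
    have h2 : c l i - c l j = (a i)⁻¹ ^ (r + 1) * (φ ((r + 1 : ℕ) * u l * u i ^ r) * c i j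
        - φ (E l i j) * (a j)⁻¹ ^ ((r + 1) * (r + 2))) := by
      have h3 := ha0 i
      have h4 := ha0 j
      have h5 : φ ((r + 1 : ℕ) * u l * u i ^ r) = (r + 1) * a l * a i ^ r := by simp [ha]
      rw [h5, h1, inv_pow, inv_pow]
      field_simp
      ring
    rw [h2]
    refine mul_mem (pow_mem (locSub_mul_left (hinv i)) _) (sub_mem (mul_mem ?_ (hcmem i j))
      (mul_mem ?_ (pow_mem (locSub_mul_right (hinv j)) _)))
    · exact locSub_mul_left (hmem _ i)
    · exact locSub_mul_left (hmem _ i)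
  choose d hd using fun l => hu.exists_of_cocycle (z := c l) (hcdiff l)
  have hδ : ∀ l m, ∃ b : B,
      φ b = a m ^ (r + 1) * d l + (r + 1) * a l * a m ^ r * d m - lam l m := by
    intro l m
    refine hu.mem_of_forall fun i => ?_
    have h1 : a m ^ (r + 1) * d l + (r + 1) * a l * a m ^ r * d m - lam l m =
        φ (E l m i) * (a i)⁻¹ ^ ((r + 1) * (r + 2)) + φ (u m ^ (r + 1)) * (d l - c l i)
        + φ ((r + 1 : ℕ) * u l * u m ^ r) * (d m - c m i) := by
      have h4 := ha0 i
      have h5 : φ ((r + 1 : ℕ) * u l * u m ^ r) = (r + 1) * a l * a m ^ r := by simp [ha]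
      have h6 : φ (u m ^ (r + 1)) = a m ^ (r + 1) := by simp [ha]
      rw [h5, h6, hE1, inv_pow]
      field_simp
      ring
    rw [h1]
    exact add_mem (add_mem (mul_mem (hmem _ i) (pow_mem (hinv i) _))
      (mul_mem (hmem _ i) (hd l i))) (mul_mem (hmem _ i) (hd m i))
  choose δ hδ using hδ
  refine ⟨δ, fun l m i => hφinj ?_⟩
  simp only [map_add, map_sub, map_mul, map_pow, map_zero, map_natCast, hδ, hE1, ha]
  rw [hlami l i, hlami m i, hlami i i, hcii]
  push_cast
  ring

end Solve

section Expand

variable {A : Type} [CommRing A]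

theorem add_pow_sub_mem {I : Ideal A} {J : ℕ} (hJ : 1 ≤ J) (b : A) {y : A}
    (hy : y ∈ I ^ J) (r : ℕ) :
    (b + y) ^ (r + 1) - (b ^ (r + 1) + (r + 1 : ℕ) * b ^ r * y) ∈ I ^ (J + 1) := by
  obtain ⟨c, hc⟩ := Polynomial.powAddExpansion b y (r + 1)
  rw [hc, Nat.add_sub_cancel, add_sub_cancel_left]
  refine Ideal.mul_mem_left _ _ (Ideal.pow_le_pow_right (show J + 1 ≤ J + J by lia) ?_)
  rw [pow_add, sq]
  exact Ideal.mul_mem_mul hy hy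

theorem mul_add_pow_sub_mem {I : Ideal A} {J : ℕ} (hJ : 1 ≤ J) (a b : A) {x y : A}
    (hx : x ∈ I ^ J) (hy : y ∈ I ^ J) (r : ℕ) :
    (a + x) * (b + y) ^ (r + 1) -
      (a * b ^ (r + 1) + b ^ (r + 1) * x + (r + 1 : ℕ) * a * b ^ r * y) ∈ I ^ (J + 1) := by
  have h1 := add_pow_sub_mem hJ b hy r
  have h2 : x * y ∈ I ^ (J + 1) := by
    refine Ideal.pow_le_pow_right (show J + 1 ≤ J + J by lia) ?_
    rw [pow_add]
    exact Ideal.mul_mem_mul hx hy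
  have : (a + x) * (b + y) ^ (r + 1) -
      (a * b ^ (r + 1) + b ^ (r + 1) * x + (r + 1 : ℕ) * a * b ^ r * y) =
      (a + x) * ((b + y) ^ (r + 1) - (b ^ (r + 1) + (r + 1 : ℕ) * b ^ r * y)) +
        (r + 1 : ℕ) * b ^ r * (x * y) := by ring
  rw [this]
  exact Ideal.add_mem _ (Ideal.mul_mem_left _ _ h1) (Ideal.mul_mem_left _ _ h2)

/-- The obstruction to the multiplicativity of `w`. -/
def obstr {ι : Type} (w : ι → ι → A) (r : ℕ) (l m i : ι) : A :=
  w l i * w m i ^ (r + 1) - w l m * w i i ^ (r + 1)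

/-- The derivative of `obstr` at `w` in the direction `δ`. -/
def dObstr {ι : Type} (w δ : ι → ι → A) (r : ℕ) (l m i : ι) : A :=
  w m i ^ (r + 1) * δ l i + (r + 1 : ℕ) * w l i * w m i ^ r * δ m i
    - w i i ^ (r + 1) * δ l m - (r + 1 : ℕ) * w l m * w i i ^ r * δ i i

theorem obstr_add_mem {ι : Type} {I : Ideal A} {J : ℕ} (hJ : 1 ≤ J) {w δ : ι → ι → A} {r : ℕ}
    (hδ : ∀ l m, δ l m ∈ I ^ J) {l m i : ι}
    (h : obstr w r l m i + dObstr w δ r l m i ∈ I ^ (J + 1)) :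
    obstr (fun a b => w a b + δ a b) r l m i ∈ I ^ (J + 1) := by
  have h1 := mul_add_pow_sub_mem hJ (w l i) (w m i) (hδ l i) (hδ m i) r
  have h2 := mul_add_pow_sub_mem hJ (w l m) (w i i) (hδ l m) (hδ i i) r
  convert Ideal.add_mem _ (Ideal.sub_mem _ h1 h2) h using 1
  unfold obstr dObstr
  ring

variable {κ : Type} {f : κ → A}

theorem compat_mem (hf : QuasiReg f) (hI : (Ideal.span (Set.range f)).IsPrime) {ι : Type}
    {w : ι → ι → A} {J r : ℕ} (hJ : 1 ≤ J)
    (h : ∀ l m i, obstr w r l m i ∈ Ideal.span (Set.range f) ^ J)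
    (hw : ∀ i, w i i ∉ Ideal.span (Set.range f)) (l m i : ι) :
    (w l m ^ (r + 2) - w l l * w m m ^ (r + 1)) * w i i ^ (r + 1)
      + ((r + 1 : ℕ) + 1) * w l m ^ (r + 1) * obstr w r l m i
      - w m m ^ (r + 1) * obstr w r l l i
      - (r + 1 : ℕ) * w l l * w m m ^ r * obstr w r m m i ∈ Ideal.span (Set.range f) ^ (J + 1) := by
  have h1 := add_pow_sub_mem hJ (w l m * w i i ^ (r + 1)) (h l m i) (r + 1)
  have h2 := mul_add_pow_sub_mem hJ (w l l * w i i ^ (r + 1)) (w m m * w i i ^ (r + 1))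
    (h l l i) (h m m i) r
  have hD : (w i i ^ (r + 1)) ^ (r + 1) ∉ Ideal.span (Set.range f) := fun h' =>
    hw i (hI.mem_of_pow_mem _ (hI.mem_of_pow_mem _ h'))
  refine hf.mem_of_mul_mem hI hD ?_
  convert Ideal.sub_mem _ h2 h1 using 1
  have e : ∀ l m, w l m * w i i ^ (r + 1) + obstr w r l m i = w l i * w m i ^ (r + 1) :=
    fun l m => by unfold obstr; ring
  rw [e, e, e]
  push_cast
  ring

theorem kappa_mem (hf : QuasiReg f) (hI : (Ideal.span (Set.range f)).IsPrime) {ι : Type}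
    {w : ι → ι → A} {J r : ℕ} (hJ : 1 ≤ J)
    (h : ∀ l m i, obstr w r l m i ∈ Ideal.span (Set.range f) ^ J)
    (hw : ∀ i, w i i ∉ Ideal.span (Set.range f)) (l m : ι) :
    w l m ^ (r + 2) - w l l * w m m ^ (r + 1) ∈ Ideal.span (Set.range f) ^ J := by
  refine hf.mem_of_mul_mem hI (a := w l l ^ (r + 1)) (fun h' => hw l (hI.mem_of_pow_mem _ h')) ?_
  have h1 := Ideal.pow_le_pow_right (Nat.le_succ J) (compat_mem hf hI hJ h hw l m l)
  rw [mul_comm]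
  have h2 := Ideal.mul_mem_left _ ((((r + 1 : ℕ) : A) + 1) * w l m ^ (r + 1)) (h l m l)
  have h3 := Ideal.mul_mem_left _ (w m m ^ (r + 1)) (h l l l)
  have h4 := Ideal.mul_mem_left _ ((r + 1 : ℕ) * w l l * w m m ^ r) (h m m l)
  convert Ideal.add_mem _ (Ideal.add_mem _ (Ideal.sub_mem _ h1 h2) h3) h4 using 1
  ring

end Expand

section Lift

variable {A B κ : Type} [CommRing A] [CommRing B] [IsDomain B] [DecompositionMonoid B]

/-- One can correct `w` so as to improve its multiplicativity by one order. -/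
theorem exists_lift_linear (k : Type) [Field k] [CharZero k] [Algebra k B] {f : κ → A}
    (hf : QuasiReg f) (π : A →+* B)
    (hker : Ideal.span (Set.range f) = RingHom.ker π)
    (ρ : B →+ B) (hρ : ∀ a b, ρ (π a * b) = π a * ρ b) (hρ1 : ρ 1 = 1)
    (hρπ : ∀ b, ∃ a, π a = ρ b)
    (F : Type) [Field F] [Algebra B F] [IsFractionRing B F] {ι : Type} [Fintype ι]
    {u : ι → B} (hu : DepthThree u) (hu0 : ∀ i, u i ≠ 0) (r : ℕ) {w : ι → ι → A}
    (hw : ∀ l m, π (w l m) = u l * u m ^ (r + 1)) {J : ℕ} (hJ : 1 ≤ J)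
    (h : ∀ l m i, obstr w r l m i ∈ Ideal.span (Set.range f) ^ J) :
    ∃ δ : ι → ι → A, (∀ l m, δ l m ∈ Ideal.span (Set.range f) ^ J) ∧
      ∀ l m i, obstr w r l m i + dObstr w δ r l m i ∈ Ideal.span (Set.range f) ^ (J + 1) := by
  classical
  have hI : (Ideal.span (Set.range f)).IsPrime := hker ▸ RingHom.ker_isPrime _
  have hmem : ∀ a, a ∈ Ideal.span (Set.range f) ↔ π a = 0 := fun a => by
    rw [hker, RingHom.mem_ker]
  have hww : ∀ i, w i i ∉ Ideal.span (Set.range f) := fun i h' => by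
    rw [hmem, hw] at h'
    exact mul_ne_zero (hu0 i) (pow_ne_zero _ (hu0 i)) h'
  choose P hP hPe using fun l m i => (mem_pow_iff_exists_form f J _).mp (h l m i)
  choose Q hQ hQe using fun l m =>
    (mem_pow_iff_exists_form f J _).mp (kappa_mem hf hI hJ h hww l m)
  have hC : ∀ (a : A) {P : MvPolynomial κ A}, P.IsHomogeneous J → (C a * P).IsHomogeneous J :=
    fun a P hP => by simpa using (isHomogeneous_C _ a).mul hP
  have hPii : ∀ l i b, π (coeff b (P l i i)) = 0 := by
    intro l i b
    rw [← hmem]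
    refine hf J _ (hP l i i) ?_ b
    rw [hPe]
    unfold obstr
    rw [sub_self]
    exact zero_mem _
  have hcomp : ∀ l m i b, π (coeff b (C (w i i ^ (r + 1)) * Q l m
      + C (((r + 1 : ℕ) + 1) * w l m ^ (r + 1)) * P l m i - C (w m m ^ (r + 1)) * P l l i
      - C ((r + 1 : ℕ) * w l l * w m m ^ r) * P m m i)) = 0 := by
    intro l m i b
    rw [← hmem]
    refine hf J _ ((((hC _ (hQ l m)).add (hC _ (hP l m i))).sub (hC _ (hP l l i))).sub
      (hC _ (hP m m i))) ?_ b
    simp only [map_add, map_sub, map_mul, eval_C, hPe, hQe]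
    have := compat_mem hf hI hJ h hww l m i
    convert this using 1
    ring
  have hsol := fun b : κ →₀ ℕ => exists_linear_solution (k := k) F hu hu0 r
    (fun l m i => π (coeff b (P l m i))) (fun l m => π (coeff b (Q l m))) (fun l i => hPii l i b)
    (fun l m i => by
      have := hcomp l m i b
      simp only [coeff_sub, coeff_add, coeff_C_mul] at this
      simp only [map_add, map_sub, map_mul, map_pow, hw, map_natCast, map_one] at this
      rw [← this]
      ring)
  choose δ hδ using hsol
  choose a ha using fun b l m => hρπ (δ b l m)
  have hδ' : ∀ b l m i, π (coeff b (P l m i) + w m i ^ (r + 1) * a b l i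
      + (r + 1 : ℕ) * w l i * w m i ^ r * a b m i - w i i ^ (r + 1) * a b l m
      - (r + 1 : ℕ) * w l m * w i i ^ r * a b i i) = 0 := by
    intro b l m i
    have h1 := congrArg ρ (hδ b l m i)
    rw [map_zero, map_sub, map_sub, map_add, map_add] at h1
    have hρ' : ∀ a, ρ (π a) = π a := fun a => by
      have := hρ a 1
      rwa [mul_one, hρ1, mul_one] at this
    rw [hρ'] at h1
    rw [← hw, ← hw, ← hw, ← hw, ← map_natCast π, ← map_pow, ← map_pow, ← map_pow, ← map_pow,
      ← map_mul, ← map_mul, ← map_mul, ← map_mul, hρ, hρ, hρ, hρ] at h1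
    simp only [map_add, map_sub, map_mul _ _ (a _ _ _), ha]
    exact h1
  let S : Finset (κ →₀ ℕ) := Finset.univ.biUnion fun x : ι × ι × ι => (P x.1 x.2.1 x.2.2).support
  have hS : ∀ b ∈ S, b.degree = J := by
    intro b hb
    obtain ⟨x, -, hx⟩ := Finset.mem_biUnion.mp hb
    rw [← hP x.1 x.2.1 x.2.2 (mem_support_iff.mp hx), Finsupp.degree_eq_weight_one]; rfl
  let Δ : ι → ι → MvPolynomial κ A := fun l m => ∑ b ∈ S, monomial b (a b l m)
  have hΔ : ∀ l m, (Δ l m).IsHomogeneous J := fun l m =>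
    IsHomogeneous.sum _ _ _ fun b hb => isHomogeneous_monomial _ (hS b hb)
  have hcoeff : ∀ l m b, coeff b (Δ l m) = if b ∈ S then a b l m else 0 := by
    intro l m b
    simp [Δ, coeff_sum, coeff_monomial]
  refine ⟨fun l m => eval f (Δ l m), fun l m => (mem_pow_iff_exists_form f J _).mpr
    ⟨_, hΔ l m, rfl⟩, fun l m i => ?_⟩
  have hform : ∀ R : MvPolynomial κ A, R.IsHomogeneous J → (∀ b, π (coeff b R) = 0) →
      eval f R ∈ Ideal.span (Set.range f) ^ (J + 1) := by
    intro R hR h0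
    rw [eval_eq, pow_succ']
    refine Ideal.sum_mem _ fun b hb => Ideal.mul_mem_mul ((hmem _).mpr (h0 b)) ?_
    have : b.degree = J := by
      rw [← hR (mem_support_iff.mp hb), Finsupp.degree_eq_weight_one]; rfl
    rw [← this, Finsupp.degree_apply, ← Finset.prod_pow_eq_pow_sum]
    exact Ideal.prod_mem_prod fun i _ =>
      Ideal.pow_mem_pow (Ideal.subset_span (Set.mem_range_self i)) _
  have := hform (P l m i + C (w m i ^ (r + 1)) * Δ l i
      + C ((r + 1 : ℕ) * w l i * w m i ^ r) * Δ m i - C (w i i ^ (r + 1)) * Δ l m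
      - C ((r + 1 : ℕ) * w l m * w i i ^ r) * Δ i i)
    (((((hP l m i).add (hC _ (hΔ l i))).add (hC _ (hΔ m i))).sub (hC _ (hΔ l m))).sub
      (hC _ (hΔ i i))) (fun b => by
      simp only [coeff_sub, coeff_add, coeff_C_mul, hcoeff]
      by_cases hb : b ∈ S
      · simp only [hb, if_true]
        exact hδ' b l m i
      · have : coeff b (P l m i) = 0 := by
          by_contra h0
          exact hb (Finset.mem_biUnion.mpr ⟨(l, m, i), Finset.mem_univ _, mem_support_iff.mpr h0⟩)
        simp [hb, this])
  simp only [map_add, map_sub, map_mul, eval_C, hPe] at this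
  convert this using 1
  unfold dObstr
  ring

end Lift

section Weights

variable {n m : ℕ} {p : Fin m → MvPolynomial (Fin n) k} {d : Fin m → ℕ}

theorem weightedHomogeneousComponent_mul {D N M : ℕ} (hM : D + N = M) {a : MvPolynomial (Fin m) k}
    (ha : IsWeightedHomogeneous d a D) (b : MvPolynomial (Fin m) k) :
    weightedHomogeneousComponent d M (a * b) = a * weightedHomogeneousComponent d N b := by
  subst hM
  let _ := weightedGradedAlgebra k d
  have h := DirectSum.coe_decompose_mul_add_of_left_mem (weightedHomogeneousSubmodule k d)
    (i := D) (j := N) (b := b) ha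
  have h1 := weightedDecomposition.decompose'_apply k d (a * b) (D + N)
  have h2 := weightedDecomposition.decompose'_apply k d b N
  rw [← h1, ← h2]
  exact h

theorem isHomogeneous_aeval_monomial (hp : ∀ i, (p i).IsHomogeneous (d i))
    (b : Fin m →₀ ℕ) (x : k) :
    (aeval p (monomial b x)).IsHomogeneous (Finsupp.weight d b) := by
  rw [aeval_monomial, algebraMap_eq]
  have : Finsupp.weight d b = 0 + ∑ i ∈ b.support, d i * b i := by
    rw [Finsupp.weight_apply, Finsupp.sum, zero_add]
    exact Finset.sum_congr rfl fun i _ => by rw [smul_eq_mul, mul_comm]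
  rw [this]
  exact (isHomogeneous_C _ x).mul (IsHomogeneous.prod _ _ _ fun i _ => (hp i).pow _)

theorem aeval_weightedHomogeneousComponent (hp : ∀ i, (p i).IsHomogeneous (d i)) (N : ℕ)
    (a : MvPolynomial (Fin m) k) :
    aeval p (weightedHomogeneousComponent d N a) = homogeneousComponent N (aeval p a) := by
  induction a using MvPolynomial.induction_on' with
  | add a b ha hb => simp only [map_add, ha, hb]
  | monomial b x =>
    have h1 := isHomogeneous_aeval_monomial hp b x
    have h2 := isWeightedHomogeneous_monomial d b x rfl
    by_cases h : Finsupp.weight d b = N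
    · rw [← h, h2.weightedHomogeneousComponent_same,
        homogeneousComponent_of_mem ((mem_homogeneousSubmodule _ _).mpr h1), if_pos rfl]
    · rw [h2.weightedHomogeneousComponent_ne _ (Ne.symm h), map_zero,
        homogeneousComponent_of_mem ((mem_homogeneousSubmodule _ _).mpr h1), if_neg (Ne.symm h)]

theorem weightedHomogeneousComponent_mem_relIdeal_pow (hp : ∀ i, (p i).IsHomogeneous (d i))
    (J N : ℕ) {a : MvPolynomial (Fin m) k} (ha : a ∈ relIdeal p ^ J) :
    weightedHomogeneousComponent d N a ∈ relIdeal p ^ J := by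
  let _ := weightedGradedAlgebra k d
  have hI : (relIdeal p).IsHomogeneous (weightedHomogeneousSubmodule k d) := by
    intro N a ha
    have h2 := weightedDecomposition.decompose'_apply k d a N
    rw [relIdeal, RingHom.mem_ker] at ha ⊢
    have h3 := aeval_weightedHomogeneousComponent hp N a
    rw [ha, map_zero, ← h2] at h3
    exact h3
  have hIJ : (relIdeal p ^ J).IsHomogeneous (weightedHomogeneousSubmodule k d) := by
    induction J with
    | zero => rw [pow_zero, Ideal.one_eq_top]; exact Ideal.IsHomogeneous.top _
    | succ J ih => rw [pow_succ]; exact (ih (Ideal.pow_le_pow_right (Nat.le_succ J) ha)).mul hI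
  exact weightedHomogeneousComponent_mem_of_mem k d hIJ ha N

theorem eq_zero_of_mem_relIdeal_pow (hp : ∀ i, (p i).IsHomogeneous (d i)) (hd : ∀ i, 0 < d i)
    {J N : ℕ} (hJ : N < J) {a : MvPolynomial (Fin m) k} (ha : a ∈ relIdeal p ^ J)
    (haN : IsWeightedHomogeneous d a N) : a = 0 := by
  have hle : relIdeal p ≤ idealOfVars (Fin m) k := by
    intro f hf
    rw [relIdeal, RingHom.mem_ker] at hf
    rw [← pow_one (idealOfVars _ _), mem_pow_idealOfVars_iff]
    intro b hb
    rw [Nat.one_le_iff_ne_zero]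
    intro h0
    rw [Finsupp.degree_eq_zero_iff] at h0
    subst h0
    rw [mem_support_iff] at hb
    apply hb
    have h1 := congrArg constantCoeff hf
    rw [map_zero, ← eval_zero', eval_aeval_pMap] at h1
    have h2 : pMap p 0 = 0 := by
      ext i
      have := (hp i).coeff_eq_zero (d := 0) (by simpa using (hd i).ne)
      simpa [pMap, eval_zero', constantCoeff_eq] using this
    rw [show (fun _ => 0 : Fin n → k) = 0 from rfl, h2] at h1
    simpa [constantCoeff_eq] using h1
  have h := (mem_pow_idealOfVars_iff ..).mp (Ideal.pow_right_mono hle J ha)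
  by_contra h0
  obtain ⟨b, hb⟩ := support_nonempty.mpr h0
  have h1 := h b hb
  have h2 := haN (mem_support_iff.mp hb)
  have h3 : b.degree ≤ Finsupp.weight d b := by
    rw [Finsupp.degree_apply, Finsupp.weight_apply, Finsupp.sum]
    exact Finset.sum_le_sum fun i _ => Nat.le_mul_of_pos_right _ (hd i)
  lia

end Weights

section Lift

variable {n m : ℕ} {p : Fin m → MvPolynomial (Fin n) k} {d : Fin m → ℕ}

/-- Lifting of the products `u l * u m ^ (r + 1)` satisfying the multiplicativity relations up to
any order. -/
theorem exists_lift_order [CharZero k] (hp : ∀ i, (p i).IsHomogeneous (d i))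
    {κ : Type} {f : κ → MvPolynomial (Fin m) k} (hf : QuasiReg f)
    (hspan : Ideal.span (Set.range f) = relIdeal p)
    (ρ : MvPolynomial (Fin n) k →+ MvPolynomial (Fin n) k)
    (hρ : ∀ (a : MvPolynomial (Fin m) k) b, ρ (aeval p a * b) = aeval p a * ρ b) (hρ1 : ρ 1 = 1)
    (hρπ : ∀ b, ∃ a : MvPolynomial (Fin m) k, aeval p a = ρ b)
    {ι : Type} [Fintype ι] {u : ι → MvPolynomial (Fin n) k} (hu : DepthThree u)
    (hu0 : ∀ i, u i ≠ 0) {e : ι → ℕ} (hue : ∀ i, (u i).IsHomogeneous (e i)) (r : ℕ)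
    (hur : ∀ l m', ∃ a : MvPolynomial (Fin m) k, aeval p a = u l * u m' ^ (r + 1)) (J : ℕ) :
    ∃ w : ι → ι → MvPolynomial (Fin m) k,
      (∀ l m, IsWeightedHomogeneous d (w l m) (e l + (r + 1) * e m)) ∧
      (∀ l m, aeval p (w l m) = u l * u m ^ (r + 1)) ∧
      ∀ l m i, obstr w r l m i ∈ relIdeal p ^ (J + 1) := by
  have hum : ∀ l m, (u l * u m ^ (r + 1)).IsHomogeneous (e l + (r + 1) * e m) := fun l m => by
    rw [mul_comm (r + 1)]; exact (hue l).mul ((hue m).pow _)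
  induction J with
  | zero =>
    choose a ha using hur
    have hw : ∀ l m, aeval p (weightedHomogeneousComponent d (e l + (r + 1) * e m) (a l m))
        = u l * u m ^ (r + 1) := fun l m => by
      rw [aeval_weightedHomogeneousComponent hp, ha, homogeneousComponent_of_mem
        ((mem_homogeneousSubmodule _ _).mpr (hum l m)), if_pos rfl]
    refine ⟨fun l m => weightedHomogeneousComponent d (e l + (r + 1) * e m) (a l m),
      fun l m => weightedHomogeneousComponent_isWeightedHomogeneous .., hw, fun l m i => ?_⟩
    rw [zero_add, pow_one, relIdeal, RingHom.mem_ker]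
    unfold obstr
    simp only [map_sub, map_mul, map_pow, hw]
    ring
  | succ J ih =>
    obtain ⟨w, hwd, hw, h⟩ := ih
    obtain ⟨δ, hδ, hδ'⟩ := exists_lift_linear k hf
      (aeval p : MvPolynomial (Fin m) k →ₐ[k] MvPolynomial (Fin n) k).toRingHom
      (hspan.trans rfl) ρ (fun a b => hρ a b) hρ1 (fun b => hρπ b)
      (FractionRing (MvPolynomial (Fin n) k)) hu hu0 r (w := w) (J := J + 1)
      (fun l m => hw l m) (Nat.le_add_left _ _)
      (by rw [hspan]; exact h)
    rw [hspan] at hδ hδ'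
    set δ' : ι → ι → MvPolynomial (Fin m) k := fun l m =>
      weightedHomogeneousComponent d (e l + (r + 1) * e m) (δ l m) with hδ'def
    have hmem : ∀ l m, δ' l m ∈ relIdeal p ^ (J + 1) := fun l m =>
      weightedHomogeneousComponent_mem_relIdeal_pow hp _ _ (hδ l m)
    refine ⟨fun l m => w l m + δ' l m, fun l m => (hwd l m).add
      (weightedHomogeneousComponent_isWeightedHomogeneous ..), fun l m => ?_, fun l m i =>
      obstr_add_mem (Nat.le_add_left _ _) hmem ?_⟩
    · have : δ' l m ∈ relIdeal p := Ideal.pow_le_self (Nat.succ_ne_zero J) (hmem l m)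
      rw [relIdeal, RingHom.mem_ker] at this
      rw [map_add, hw, this, add_zero]
    · have h1 := weightedHomogeneousComponent_mem_relIdeal_pow hp _
        ((e l + (r + 1) * e i) + (r + 1) * (e m + (r + 1) * e i)) (hδ' l m i)
      have hnat : ∀ D (a : MvPolynomial _ k), IsWeightedHomogeneous d a D →
          IsWeightedHomogeneous d (((r + 1 : ℕ) : MvPolynomial _ k) * a) D := fun D a ha => by
        rw [← map_natCast C]; exact ha.C_mul _
      have hpow : ∀ D (a : MvPolynomial _ k) (N : ℕ), IsWeightedHomogeneous d a D →
          IsWeightedHomogeneous d (a ^ N) (N * D) := fun D a N ha => by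
        simpa using ha.pow N
      have ho : IsWeightedHomogeneous d (obstr w r l m i)
          ((e l + (r + 1) * e i) + (r + 1) * (e m + (r + 1) * e i)) := by
        refine ((hwd l i).mul (hpow _ _ _ (hwd m i))).sub ?_
        rw [show e l + (r + 1) * e i + (r + 1) * (e m + (r + 1) * e i) =
          e l + (r + 1) * e m + (r + 1) * (e i + (r + 1) * e i) by ring]
        exact (hwd l m).mul (hpow _ _ _ (hwd i i))
      convert h1 using 1
      unfold dObstr
      rw [map_add, ho.weightedHomogeneousComponent_same, map_sub, map_sub, map_add,
        weightedHomogeneousComponent_mul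
          (show ((r + 1) * (e m + (r + 1) * e i)) +
            (e l + (r + 1) * e i) = _ by ring)
          (hpow _ _ _ (hwd m i)),
        weightedHomogeneousComponent_mul
          (show ((e l + (r + 1) * e i) + r * (e m + (r + 1) * e i)) +
            (e m + (r + 1) * e i) = _ by ring)
          ((hnat _ _ (hwd l i)).mul (hpow _ _ _ (hwd m i))),
        weightedHomogeneousComponent_mul
          (show ((r + 1) * (e i + (r + 1) * e i)) +
            (e l + (r + 1) * e m) = _ by ring)
          (hpow _ _ _ (hwd i i)),
        weightedHomogeneousComponent_mul
          (show ((e l + (r + 1) * e m) + r * (e i + (r + 1) * e i)) +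
            (e i + (r + 1) * e i) = _ by ring)
          ((hnat _ _ (hwd l m)).mul (hpow _ _ _ (hwd i i)))]

/-- There are liftings of the products `u l * u m ^ (r + 1)` satisfying the same multiplicative
relations. -/
theorem exists_lift [CharZero k] (hp : ∀ i, (p i).IsHomogeneous (d i)) (hd : ∀ i, 0 < d i)
    {κ : Type} {f : κ → MvPolynomial (Fin m) k} (hf : QuasiReg f)
    (hspan : Ideal.span (Set.range f) = relIdeal p)
    (ρ : MvPolynomial (Fin n) k →+ MvPolynomial (Fin n) k)
    (hρ : ∀ (a : MvPolynomial (Fin m) k) b, ρ (aeval p a * b) = aeval p a * ρ b) (hρ1 : ρ 1 = 1)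
    (hρπ : ∀ b, ∃ a : MvPolynomial (Fin m) k, aeval p a = ρ b)
    {ι : Type} [Fintype ι] {u : ι → MvPolynomial (Fin n) k} (hu : DepthThree u)
    (hu0 : ∀ i, u i ≠ 0) {e : ι → ℕ} (hue : ∀ i, (u i).IsHomogeneous (e i)) (r : ℕ)
    (hur : ∀ l m', ∃ a : MvPolynomial (Fin m) k, aeval p a = u l * u m' ^ (r + 1)) :
    ∃ w : ι → ι → MvPolynomial (Fin m) k,
      (∀ l m, aeval p (w l m) = u l * u m ^ (r + 1)) ∧
      ∀ l m, w l m ^ (r + 2) = w l l * w m m ^ (r + 1) := by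
  obtain ⟨J, hJ⟩ : ∃ J, ∀ l m, (r + 2) * (e l + (r + 1) * e m) ≤ J := by
    refine ⟨∑ x : ι × ι, (r + 2) * (e x.1 + (r + 1) * e x.2), fun l m => ?_⟩
    exact Finset.single_le_sum (f := fun x : ι × ι => (r + 2) * (e x.1 + (r + 1) * e x.2))
      (fun _ _ => Nat.zero_le _) (Finset.mem_univ (l, m))
  obtain ⟨w, hwd, hw, h⟩ := exists_lift_order hp hf hspan ρ hρ hρ1 hρπ hu hu0 hue r hur J
  refine ⟨w, hw, fun l m => ?_⟩
  rw [← hspan] at h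
  have h1 := kappa_mem hf (hspan ▸ isPrime_relIdeal) (Nat.le_add_left _ _) h (fun i h' => by
    rw [hspan, relIdeal, RingHom.mem_ker, hw] at h'
    exact mul_ne_zero (hu0 i) (pow_ne_zero _ (hu0 i)) h') l m
  rw [hspan] at h1
  refine sub_eq_zero.mp (eq_zero_of_mem_relIdeal_pow hp hd (Nat.lt_succ_of_le (hJ l m)) h1
    (IsWeightedHomogeneous.sub ?_ ?_))
  · simpa only [smul_eq_mul] using (hwd l m).pow (r + 2)
  · rw [show (r + 2) * (e l + (r + 1) * e m) = e l + (r + 1) * e l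
      + (r + 1) • (e m + (r + 1) * e m) by rw [smul_eq_mul]; ring]
    exact (hwd l l).mul ((hwd m m).pow (r + 1))

end Lift

section PowerFree

variable {A : Type} [CommRing A] [UniqueFactorizationMonoid A]

theorem exists_eq_mul_pow {N : ℕ} (hN : N ≠ 0) {a : A} (ha : a ≠ 0) :
    ∃ c g : A, a = c * g ^ N ∧ ∀ x, x ^ N ∣ c → IsUnit x := by
  induction a using IsWellFounded.induction (DvdNotUnit : A → A → Prop) with
  | _ a ih =>
    by_cases h : ∀ x, x ^ N ∣ a → IsUnit x
    · exact ⟨a, 1, by simp, h⟩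
    · push Not at h
      obtain ⟨x, ⟨b, rfl⟩, hx⟩ := h
      have hb : b ≠ 0 := right_ne_zero_of_mul ha
      obtain ⟨c, g, hcg, hc⟩ :=
        ih b ⟨hb, x ^ N, fun h => hx ((isUnit_pow_iff hN).mp h), mul_comm _ _⟩ hb
      exact ⟨c, g * x, by rw [hcg, mul_pow]; ring, hc⟩

variable [IsDomain A]

theorem dvd_of_pow_dvd_mul {N : ℕ} {c v x : A} (hv : v ≠ 0)
    (hc : ∀ x, x ^ N ∣ c → IsUnit x) (h : v ^ N ∣ x ^ N * c) : v ∣ x := by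
  obtain ⟨v', x', D, hrel, rfl, rfl⟩ := UniqueFactorizationMonoid.exists_reduced_factors v hv x
  rw [mul_pow, mul_pow, mul_assoc] at h
  have h1 := (mul_dvd_mul_iff_left (pow_ne_zero N (left_ne_zero_of_mul hv))).mp h
  have h2 := (hc v' ((hrel.pow (m := N) (n := N)).dvd_of_dvd_mul_left h1))
  exact mul_dvd_mul_left _ h2.dvd

theorem dvd_of_pow_dvd_pow {N : ℕ} (hN : N ≠ 0) {v x : A} (hv : v ≠ 0) (h : v ^ N ∣ x ^ N) :
    v ∣ x :=
  dvd_of_pow_dvd_mul (c := 1) hv (fun _ hx => isUnit_of_dvd_one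
    ((dvd_pow_self _ hN).trans hx)) (by simpa using h)

end PowerFree

/-- Multiplicative liftings of the products `u l * u m ^ (r + 1)` force the `u l` to be liftable
up to constants. -/
theorem exists_eq_C_mul [IsAlgClosed k] {σ τ : Type}
    (π : MvPolynomial σ k →ₐ[k] MvPolynomial τ k) {ι : Type} {u : ι → MvPolynomial τ k}
    (hu : DepthThree u) (hu0 : ∀ i, u i ≠ 0) (r : ℕ) {w : ι → ι → MvPolynomial σ k}
    (hw : ∀ l m, π (w l m) = u l * u m ^ (r + 1))
    (hww : ∀ l m, w l m ^ (r + 2) = w l l * w m m ^ (r + 1)) (o : ι) :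
    ∃ (c : k) (g : MvPolynomial σ k), u o = C c * π g := by
  have hw0 : ∀ l, w l l ≠ 0 := fun l h => by
    have := hw l l
    rw [h, map_zero] at this
    exact mul_ne_zero (hu0 l) (pow_ne_zero _ (hu0 l)) this.symm
  have hN : r + 2 ≠ 0 := by lia
  obtain ⟨c, g, hcg, hc⟩ := exists_eq_mul_pow hN (hw0 o)
  have hdvd : ∀ l, π c ∣ u l ^ (r + 2) := by
    intro l
    have h1 : (w l o * g) ^ (r + 2) * c = w l l * w o o ^ (r + 2) := by
      rw [mul_pow, mul_assoc, mul_comm _ c, ← hcg, hww]; ring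
    obtain ⟨t, ht⟩ := dvd_of_pow_dvd_mul (hw0 o) hc ⟨w l l, by rw [h1, mul_comm]⟩
    have h2 : w l l = t ^ (r + 2) * c := by
      apply mul_right_cancel₀ (pow_ne_zero (r + 2) (hw0 o))
      rw [← h1, ht]; ring
    have h3 := hw l l
    rw [h2, map_mul] at h3
    exact ⟨π (t ^ (r + 2)), by rw [mul_comm, h3]; ring⟩
  obtain ⟨s, hs, -, hreg⟩ := hu
  obtain ⟨M, hM⟩ := exists_pow_mem hs (r + 2)
  have hle : Ideal.span (Set.range fun i => u i ^ (r + 2)) ≤ Ideal.span {π c} := by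
    rw [Ideal.span_le]
    rintro _ ⟨i, rfl⟩
    exact Ideal.mem_span_singleton.mpr (hdvd i)
  have hunit : IsUnit (π c) := (hreg M).1 (Ideal.mem_span_singleton.mp (hle (hM 0)))
    (Ideal.mem_span_singleton.mp (hle (hM 1)))
  obtain ⟨a, -, ha⟩ := (MvPolynomial.isUnit_iff_eq_C_of_isReduced).mp hunit
  obtain ⟨b, hb⟩ := IsAlgClosed.exists_pow_nat_eq a (Nat.pos_of_ne_zero hN)
  have h4 : u o ^ (r + 2) = (C b * π g) ^ (r + 2) := by
    have := hw o o
    rw [hcg, map_mul, map_pow, ha, ← hb, map_pow, ← mul_pow] at this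
    rw [this]; ring
  have h5 : C b * π g ≠ 0 := fun h => by
    rw [h, zero_pow hN] at h4
    exact hu0 o (pow_eq_zero_iff hN |>.mp h4)
  obtain ⟨t, ht⟩ := dvd_of_pow_dvd_pow hN h5 (h4 ▸ dvd_rfl : (C b * π g) ^ (r + 2) ∣ u o ^ (r + 2))
  have h6 : t ^ (r + 2) = 1 := by
    apply mul_left_cancel₀ (pow_ne_zero (r + 2) h5)
    rw [← mul_pow, ← ht, h4, mul_one]
  obtain ⟨e, -, he⟩ := (MvPolynomial.isUnit_iff_eq_C_of_isReduced).mp (IsUnit.of_pow_eq_one h6 hN)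
  exact ⟨b * e, g, by rw [ht, he, map_mul]; ring⟩

/-! ### Triviality of characters -/

section Purity

variable {n m : ℕ} {G : Subgroup (Matrix.GeneralLinearGroup (Fin n) k)} [Fintype G]

/-- The nonzero homogeneous semi-invariants of character `χ`. -/
def semiInvariants (χ : G →* kˣ) : Set (MvPolynomial (Fin n) k) :=
  {f | f ≠ 0 ∧ (∃ e, f.IsHomogeneous e) ∧
    ∀ g : G, matAct (g : Matrix.GeneralLinearGroup (Fin n) k) f = (χ g).val • f}

theorem exists_mulVec_eq_of_semiInvariants [CharZero k] (χ : G →* kˣ) {x : Fin n → k}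
    (hx : ∀ f ∈ semiInvariants χ, eval x f = 0) :
    ∃ g : G, χ g ≠ 1 ∧ (↑(g : Matrix.GeneralLinearGroup (Fin n) k) :
      Matrix (Fin n) (Fin n) k).mulVec x = x := by
  classical
  by_contra! h
  have h0 : ∀ q, eval x (semi χ q) = 0 := by
    intro q
    rw [← sum_homogeneousComponent q, map_sum, map_sum]
    refine Finset.sum_eq_zero fun i _ => ?_
    by_cases hz : semi χ (homogeneousComponent i q) = 0
    · rw [hz, map_zero]
    · exact hx _ ⟨hz, ⟨i, isHomogeneous_semi χ (homogeneousComponent_isHomogeneous i q)⟩,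
        matAct_semi χ _⟩
  obtain ⟨q, hq1, hq⟩ := exists_eval_separating x ((Finset.univ.image fun g : G =>
    Matrix.mulVec (↑((g : Matrix.GeneralLinearGroup (Fin n) k)⁻¹) :
        Matrix (Fin n) (Fin n) k) x).erase x) (Finset.notMem_erase _ _)
  have h1 := h0 q
  rw [eval_semi] at h1
  have h2 : ∀ g : G, ((χ g)⁻¹ : kˣ).val *
      eval (Matrix.mulVec (↑((g : Matrix.GeneralLinearGroup (Fin n) k)⁻¹) :
        Matrix (Fin n) (Fin n) k) x) q =
      if Matrix.mulVec (↑((g : Matrix.GeneralLinearGroup (Fin n) k)⁻¹) :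
        Matrix (Fin n) (Fin n) k) x = x then 1 else 0 := by
    intro g
    split_ifs with hg
    · have h3 : χ g⁻¹ = 1 := by
        by_contra h4
        exact h g⁻¹ h4 hg
      rw [map_inv] at h3
      rw [hg, hq1, h3, Units.val_one, one_mul]
    · rw [hq _ (Finset.mem_erase.mpr ⟨hg, Finset.mem_image_of_mem _ (Finset.mem_univ g)⟩), mul_zero]
  rw [Finset.sum_congr rfl fun g _ => h2 g, Finset.sum_boole, Nat.cast_eq_zero,
    Finset.card_eq_zero] at h1
  have : (1 : G) ∈ (∅ : Finset G) := by
    rw [← h1]; simp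
  simp at this

variable {p : Fin m → MvPolynomial (Fin n) k} {d : Fin m → ℕ}

/-- If the ring of invariants of `G` is a complete intersection, a character of `G` which is
trivial on the elements fixing pointwise a subspace of codimension at most two is trivial. -/
theorem character_eq_one [IsAlgClosed k] [CharZero k]
    (hgen : Algebra.adjoin k (Set.range p) = invariants G)
    (hp : ∀ i, (p i).IsHomogeneous (d i)) (hd : ∀ i, 0 < d i)
    {s : Finset (MvPolynomial (Fin m) k)} (hcard : s.card = m - n)
    (hs : Ideal.span (s : Set (MvPolynomial (Fin m) k)) = relIdeal p) (χ : G →* kˣ)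
    (hχ : ∀ g : G, χ g ≠ 1 → Module.finrank k (fixK ((g : Matrix.GeneralLinearGroup (Fin n) k) :
      Matrix (Fin n) (Fin n) k)) + 3 ≤ n) : χ = 1 := by
  classical
  have hcard0 : (Fintype.card G : k) ≠ 0 := Nat.cast_ne_zero.mpr Fintype.card_ne_zero
  obtain ⟨t, htS, ht⟩ := (Submodule.fg_span_iff_fg_span_finset_subset (semiInvariants χ)).mp
    (IsNoetherian.noetherian (Ideal.span (semiInvariants χ)))
  have hzero : ∀ x : Fin n → k, (∀ f ∈ t, eval x f = 0) → ∃ g : G, χ g ≠ 1 ∧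
      (↑(g : Matrix.GeneralLinearGroup (Fin n) k) : Matrix (Fin n) (Fin n) k).mulVec x = x := by
    intro x hx
    refine exists_mulVec_eq_of_semiInvariants χ fun f hf => ?_
    have h1 : Ideal.span (t : Set (MvPolynomial (Fin n) k)) ≤ RingHom.ker (eval x) :=
      Ideal.span_le.mpr hx
    exact h1 (ht ▸ Ideal.subset_span hf : f ∈ Submodule.span _ (t : Set (MvPolynomial (Fin n) k)))
  let u : t → MvPolynomial (Fin n) k := Subtype.val
  have hu : DepthThree u := by
    obtain ⟨s₀, s₁, s₂, hv, h0, h1, h2, hreg⟩ := exists_regular_triple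
      (fun g : {g : G // χ g ≠ 1} => ((g.1 : Matrix.GeneralLinearGroup (Fin n) k) :
        Matrix (Fin n) (Fin n) k)) fun g => hχ g.1 g.2
    refine ⟨![s₀, s₁, s₂], ?_, by intro a; fin_cases a <;> assumption, hreg⟩
    intro a
    rw [← vanishingIdeal_zeroLocus_eq_radical (k := k) (K := k), mem_vanishingIdeal_iff]
    intro x hx
    rw [mem_zeroLocus_iff] at hx
    obtain ⟨g, hg, hgx⟩ := hzero x fun f hf => hx f (Ideal.subset_span ⟨⟨f, hf⟩, rfl⟩)
    have := hv ⟨g, hg⟩ x hgx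
    fin_cases a
    exacts [this.1, this.2.1, this.2.2]
  have hu0 : ∀ i, u i ≠ 0 := fun i => (htS i.2).1
  have hsemi : ∀ (i : t) (g : G), matAct (g : Matrix.GeneralLinearGroup (Fin n) k) (u i) =
    (χ g).val • u i := fun i => (htS i.2).2.2
  choose e he using fun i : t => (htS i.2).2.1
  obtain ⟨r, hr⟩ : ∃ r, r + 2 = 2 * Fintype.card G :=
    ⟨2 * Fintype.card G - 2, by have := Fintype.card_pos (α := G); lia⟩
  let ρ : MvPolynomial (Fin n) k →+ MvPolynomial (Fin n) k :=
    ((Fintype.card G : k)⁻¹ • semi (1 : G →* kˣ)).toAddMonoidHom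
  have hρ : ∀ b, ρ b = (Fintype.card G : k)⁻¹ • semi (1 : G →* kˣ) b := fun _ => rfl
  have hspan : Ideal.span (Set.range fun f : s => f.1) = relIdeal p := by
    rw [← hs]; congr 1; ext; simp
  obtain ⟨w, hw, hww⟩ := exists_lift hp hd (quasiReg_relations hgen hcard hs) hspan ρ
    (fun a b => by
      rw [hρ, hρ, semi_mul _ ((mem_invariants_iff hgen).mpr ⟨a, rfl⟩), mul_smul_comm])
    (by rw [hρ, semi_of_semi _ (fun g => by simp), smul_smul, inv_mul_cancel₀ hcard0, one_smul])
    (fun b => (mem_invariants_iff hgen).mp (Subalgebra.smul_mem _ (semi_one_mem b) _))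
    hu hu0 he r (fun l i => (mem_invariants_iff hgen).mp fun g hg => by
      have h1 : (χ ⟨g, hg⟩).val ^ (r + 2) = 1 := by
        rw [hr, mul_comm, pow_mul, ← Units.val_pow_eq_pow_val, ← map_pow, pow_card_eq_one, map_one,
          Units.val_one, one_pow]
      rw [map_mul, map_pow, hsemi l ⟨g, hg⟩, hsemi i ⟨g, hg⟩, smul_pow, smul_mul_smul_comm,
        ← pow_succ', h1, one_smul])
  obtain ⟨o⟩ : Nonempty t := by
    obtain ⟨x, hx⟩ := exists_trivStab (G := G)
    by_contra hne
    obtain ⟨g, hg, hgx⟩ := hzero x fun f hf => (hne ⟨⟨f, hf⟩⟩).elim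
    exact hg (by rw [show g = 1 from Subtype.ext (hx g g.2 hgx), map_one])
  obtain ⟨c, a, hca⟩ := exists_eq_C_mul _ hu hu0 r hw hww o
  have hinv : u o ∈ invariants G := by
    rw [hca]
    exact mul_mem (Subalgebra.algebraMap_mem _ c) ((mem_invariants_iff hgen).mpr ⟨a, rfl⟩)
  ext g
  have h1 := hsemi o g
  rw [hinv g g.2, eq_comm, ← sub_eq_zero] at h1
  nth_rw 2 [← one_smul k (u o)] at h1
  rw [← sub_smul] at h1
  exact sub_eq_zero.mp ((smul_eq_zero.mp h1).resolve_right (hu0 o))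

end Purity

/-! ### Extension of the base field -/

section BaseChange

variable {K : Type} [Field K] [Algebra k K]

/-- Application of a linear form `K → k` to the coefficients of a polynomial. -/
def coeffMap {σ : Type} (l : K →ₗ[k] k) (f : MvPolynomial σ K) : MvPolynomial σ k :=
  ∑ u ∈ f.support, monomial u (l (coeff u f))

theorem coeff_coeffMap {σ : Type} (l : K →ₗ[k] k) (f : MvPolynomial σ K) (u : σ →₀ ℕ) :
    coeff u (coeffMap l f) = l (coeff u f) := by
  classical
  simp only [coeffMap, coeff_sum, coeff_monomial, Finset.sum_ite_eq', mem_support_iff]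
  split_ifs with h
  · rfl
  · rw [not_not.mp h, map_zero]

theorem coeffMap_add {σ : Type} (l : K →ₗ[k] k) (f g : MvPolynomial σ K) :
    coeffMap l (f + g) = coeffMap l f + coeffMap l g := by
  ext u
  simp only [coeff_coeffMap, coeff_add, map_add]

theorem coeffMap_zero {σ : Type} (l : K →ₗ[k] k) :
    coeffMap l (0 : MvPolynomial σ K) = 0 := by
  ext u
  simp [coeff_coeffMap]

theorem coeffMap_C_mul_map {σ : Type} (l : K →ₗ[k] k) (a : K) (g : MvPolynomial σ k) :
    coeffMap l (C a * map (algebraMap k K) g) = C (l a) * g := by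
  ext u
  rw [coeff_coeffMap, coeff_C_mul, coeff_map, coeff_C_mul, mul_comm, ← Algebra.smul_def,
    map_smul, smul_eq_mul, mul_comm]

theorem map_aeval_baseChange {n m : ℕ} (p : Fin m → MvPolynomial (Fin n) k)
    (a : MvPolynomial (Fin m) k) :
    map (algebraMap k K) (aeval p a) =
      aeval (fun i => map (algebraMap k K) (p i)) (map (algebraMap k K) a) := by
  induction a using MvPolynomial.induction_on with
  | C a => simp only [algHom_C, map_C, algebraMap_eq]
  | add f g hf hg => simp only [map_add, hf, hg]
  | mul_X f i hf => simp only [map_mul, hf, aeval_X, map_X]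

theorem monomial_eq_C_mul_map {σ : Type} (u : σ →₀ ℕ) (a : K) :
    monomial u a = C a * map (algebraMap k K) (monomial u 1) := by
  rw [map_monomial, map_one, C_mul_monomial, mul_one]

theorem coeffMap_aeval {n m : ℕ} (l : K →ₗ[k] k) (p : Fin m → MvPolynomial (Fin n) k)
    (f : MvPolynomial (Fin m) K) :
    coeffMap l (aeval (fun i => map (algebraMap k K) (p i)) f) = aeval p (coeffMap l f) := by
  induction f using MvPolynomial.induction_on' with
  | monomial u a =>
    rw [monomial_eq_C_mul_map (k := k), map_mul, ← map_aeval_baseChange, algHom_C, algebraMap_eq,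
      coeffMap_C_mul_map, coeffMap_C_mul_map, map_mul, algHom_C, algebraMap_eq]
  | add f g hf hg => simp only [map_add, coeffMap_add, hf, hg]

theorem exists_eq_sum_C_mul_map {σ : Type} {ι : Type} (B : Module.Basis ι k K)
    (f : MvPolynomial σ K) :
    ∃ T : Finset ι, f = ∑ b ∈ T, C (B b) * map (algebraMap k K) (coeffMap (B.coord b) f) := by
  classical
  refine ⟨f.support.biUnion fun u => (B.repr (coeff u f)).support, ?_⟩
  ext u
  simp only [coeff_sum, coeff_C_mul, coeff_map, coeff_coeffMap, Module.Basis.coord_apply]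
  by_cases hu : u ∈ f.support
  · rw [← Finset.sum_subset (Finset.subset_biUnion_of_mem
      (fun u => (B.repr (coeff u f)).support) hu)]
    · conv_lhs => rw [← B.linearCombination_repr (coeff u f), Finsupp.linearCombination_apply,
        Finsupp.sum]
      exact Finset.sum_congr rfl fun b _ => by rw [Algebra.smul_def, mul_comm]
    · intro b _ hb
      rw [Finsupp.notMem_support_iff.mp hb, map_zero, mul_zero]
  · rw [notMem_support_iff.mp hu]
    simp

theorem relIdeal_baseChange {n m : ℕ} {p : Fin m → MvPolynomial (Fin n) k}
    {s : Set (MvPolynomial (Fin m) k)} (hs : Ideal.span s = relIdeal p) :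
    Ideal.span (map (algebraMap k K) '' s) =
      relIdeal fun i => map (algebraMap k K) (p i) := by
  refine le_antisymm ?_ fun f hf => ?_
  · rw [Ideal.span_le]
    rintro _ ⟨g, hg, rfl⟩
    have hg' : g ∈ relIdeal p := hs ▸ Ideal.subset_span hg
    have hg0 : aeval p g = 0 := hg'
    change aeval (fun i => map (algebraMap k K) (p i)) (map (algebraMap k K) g) = 0
    rw [← map_aeval_baseChange, hg0, map_zero]
  · obtain ⟨T, hT⟩ := exists_eq_sum_C_mul_map (Module.Basis.ofVectorSpace k K) f
    rw [hT]
    refine Ideal.sum_mem _ fun b _ => Ideal.mul_mem_left _ _ ?_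
    have hmem : coeffMap ((Module.Basis.ofVectorSpace k K).coord b) f ∈ relIdeal p := by
      have hf0 : aeval (fun i => map (algebraMap k K) (p i)) f = 0 := hf
      change aeval p _ = 0
      rw [← coeffMap_aeval, hf0, coeffMap_zero]
    rw [← hs] at hmem
    rw [← Ideal.map_span]
    exact Ideal.mem_map_of_mem _ hmem

theorem finrank_fixK_map_le {n : ℕ} (M : Matrix (Fin n) (Fin n) k) :
    Module.finrank K (fixK (M.map (algebraMap k K))) ≤ Module.finrank k (fixK M) := by
  classical
  let b := Module.finBasis k (fixK M)
  let w : Fin (Module.finrank k (fixK M)) → Fin n → K :=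
    fun j i => algebraMap k K ((b j : Fin n → k) i)
  have hspan : ∀ x ∈ fixK M, (fun i => algebraMap k K (x i)) ∈ Submodule.span K (Set.range w) := by
    intro x hx
    have hsum : (fun i => algebraMap k K (x i)) =
        ∑ j, algebraMap k K (b.repr ⟨x, hx⟩ j) • w j := by
      ext i
      have hi := congrFun (congrArg Subtype.val (b.sum_repr ⟨x, hx⟩)) i
      simp only [AddSubmonoidClass.coe_finsetSum, SetLike.val_smul, Finset.sum_apply,
        Pi.smul_apply, smul_eq_mul] at hi
      simp only [Finset.sum_apply, Pi.smul_apply, smul_eq_mul, w, ← map_mul, ← map_sum, hi]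
    rw [hsum]
    exact Submodule.sum_mem _ fun j _ => Submodule.smul_mem _ _ (Submodule.subset_span ⟨j, rfl⟩)
  have hle : fixK (M.map (algebraMap k K)) ≤ Submodule.span K (Set.range w) := by
    intro v hv
    let B := Module.Basis.ofVectorSpace k K
    have hfix : ∀ β, (fun i => B.coord β (v i)) ∈ fixK M := by
      intro β
      rw [mem_fixK] at hv ⊢
      ext i
      have := congrArg (fun y => B.coord β (y i)) hv
      simp only [Matrix.mulVec, dotProduct, Matrix.map_apply, map_sum, ← Algebra.smul_def,
        map_smul, smul_eq_mul] at this ⊢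
      exact this
    have hv' : v = ∑ β ∈ Finset.univ.biUnion (fun i => (B.repr (v i)).support),
        B β • fun i => algebraMap k K (B.coord β (v i)) := by
      ext i
      simp only [Finset.sum_apply, Pi.smul_apply, smul_eq_mul, Module.Basis.coord_apply]
      rw [← Finset.sum_subset (Finset.subset_biUnion_of_mem
        (fun i => (B.repr (v i)).support) (Finset.mem_univ i))]
      · conv_lhs => rw [← B.linearCombination_repr (v i), Finsupp.linearCombination_apply,
          Finsupp.sum]
        exact Finset.sum_congr rfl fun b _ => by rw [Algebra.smul_def, mul_comm]
      · intro β _ hβ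
        rw [Finsupp.notMem_support_iff.mp hβ, map_zero, mul_zero]
    rw [hv']
    exact Submodule.sum_mem _ fun β _ => Submodule.smul_mem _ _ (hspan _ (hfix β))
  calc Module.finrank K (fixK (M.map (algebraMap k K)))
      ≤ Module.finrank K (Submodule.span K (Set.range w)) := Submodule.finrank_mono hle
    _ ≤ Fintype.card (Fin (Module.finrank k (fixK M))) := finrank_range_le_card w
    _ = Module.finrank k (fixK M) := Fintype.card_fin _

theorem map_matAct {n : ℕ} (g : Matrix.GeneralLinearGroup (Fin n) k)
    (f : MvPolynomial (Fin n) k) :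
    map (algebraMap k K) (matAct g f) =
      matAct (Matrix.GeneralLinearGroup.map (algebraMap k K) g) (map (algebraMap k K) f) := by
  rw [matAct, matAct, map_aeval_baseChange]
  congr 2
  ext1 i
  rw [← map_inv]
  simp only [map_sum, smul_eq_C_mul, map_mul, map_C, map_X, Matrix.GeneralLinearGroup.map_apply]

theorem generalLinearGroup_map_injective {n : ℕ} :
    Function.Injective
      (Matrix.GeneralLinearGroup.map (n := Fin n) (algebraMap k K)) := by
  intro g h hgh
  ext i j
  apply (algebraMap k K).injective
  rw [← Matrix.GeneralLinearGroup.map_apply, hgh, Matrix.GeneralLinearGroup.map_apply]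

variable (K) in
/-- The image of `G` over a field extension, as a group isomorphic to `G`. -/
def baseChangeEquiv {n : ℕ} (G : Subgroup (Matrix.GeneralLinearGroup (Fin n) k)) :
    G ≃* G.map (Matrix.GeneralLinearGroup.map (algebraMap k K)) :=
  G.equivMapOfInjective _ generalLinearGroup_map_injective

theorem adjoin_baseChange {n m : ℕ} {G : Subgroup (Matrix.GeneralLinearGroup (Fin n) k)}
    [Finite G] [CharZero k] {p : Fin m → MvPolynomial (Fin n) k}
    (hgen : Algebra.adjoin k (Set.range p) = invariants G) :
    Algebra.adjoin K (Set.range fun i => map (algebraMap k K) (p i)) =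
      invariants (G.map (Matrix.GeneralLinearGroup.map (algebraMap k K))) := by
  have : CharZero K := charZero_of_injective_algebraMap (algebraMap k K).injective
  have := Fintype.ofFinite G
  have := Fintype.ofEquiv G (baseChangeEquiv K G).toEquiv
  refine le_antisymm ?_ fun f hf => ?_
  · rw [Algebra.adjoin_le_iff]
    rintro _ ⟨i, rfl⟩ _ ⟨g, hg, rfl⟩
    have hpi : p i ∈ invariants G := hgen ▸ Algebra.subset_adjoin ⟨i, rfl⟩
    rw [← map_matAct, hpi g hg]
  · have hmap : ∀ b : MvPolynomial (Fin n) k,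
        semi (1 : G.map (Matrix.GeneralLinearGroup.map (algebraMap k K)) →* Kˣ)
          (map (algebraMap k K) b) = map (algebraMap k K) (semi (1 : G →* kˣ) b) := by
      intro b
      simp only [semi_apply, MonoidHom.one_apply, inv_one, Units.val_one, one_smul, map_sum,
        map_matAct]
      exact (Fintype.sum_equiv (baseChangeEquiv K G).toEquiv _ _ fun g => rfl).symm
    have hmem : ∀ f : MvPolynomial (Fin n) K,
        semi (1 : G.map (Matrix.GeneralLinearGroup.map (algebraMap k K)) →* Kˣ) f ∈
          Algebra.adjoin K (Set.range fun i => map (algebraMap k K) (p i)) := by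
      intro f
      induction f using MvPolynomial.induction_on' with
      | monomial u a =>
        rw [monomial_eq_C_mul_map (k := k), ← smul_eq_C_mul, map_smul, hmap]
        refine Subalgebra.smul_mem _ ?_ _
        obtain ⟨q, hq⟩ := (mem_invariants_iff hgen).mp (semi_one_mem (G := G) (monomial u 1))
        rw [← hq, map_aeval_baseChange, Algebra.adjoin_range_eq_range_aeval]
        exact ⟨_, rfl⟩
      | add f g hf hg =>
        rw [map_add]
        exact add_mem hf hg
    have hf1 : semi (1 : G.map (Matrix.GeneralLinearGroup.map (algebraMap k K)) →* Kˣ) f =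
        (Fintype.card (G.map (Matrix.GeneralLinearGroup.map (algebraMap k K))) : K) • f := by
      rw [semi_apply, Finset.sum_congr rfl fun g _ => by
        rw [hf g g.2, MonoidHom.one_apply, inv_one, Units.val_one, one_smul]]
      rw [Finset.sum_const, Finset.card_univ, Nat.cast_smul_eq_nsmul]
    have hcard : (Fintype.card (G.map (Matrix.GeneralLinearGroup.map (algebraMap k K))) : K) ≠ 0 :=
      Nat.cast_ne_zero.mpr Fintype.card_ne_zero
    have := Subalgebra.smul_mem _ (hmem f)
      (Fintype.card (G.map (Matrix.GeneralLinearGroup.map (algebraMap k K))) : K)⁻¹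
    rwa [hf1, inv_smul_smul₀ hcard] at this

/-- A character of `G` with values in an algebraically closed extension is trivial if its kernel
contains all elements fixing a subspace of codimension at most two, provided the algebra of
invariants of `G` is a complete intersection. -/
theorem character_eq_one_of_extension [IsAlgClosed K] [CharZero k] {n m : ℕ}
    {G : Subgroup (Matrix.GeneralLinearGroup (Fin n) k)} [Finite G]
    {p : Fin m → MvPolynomial (Fin n) k} {d : Fin m → ℕ}
    (hgen : Algebra.adjoin k (Set.range p) = invariants G)
    (hp : ∀ i, (p i).IsHomogeneous (d i)) (hd : ∀ i, 0 < d i)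
    (hci : IsCompleteIntersection p) (χ : G →* Kˣ)
    (hχ : ∀ g : G, χ g ≠ 1 → Module.finrank k (fixK ((g : Matrix.GeneralLinearGroup (Fin n) k) :
      Matrix (Fin n) (Fin n) k)) + 3 ≤ n) : χ = 1 := by
  classical
  obtain ⟨s, hcard, hs⟩ := hci
  have : CharZero K := charZero_of_injective_algebraMap (algebraMap k K).injective
  have := Fintype.ofFinite G
  have := Fintype.ofEquiv G (baseChangeEquiv K G).toEquiv
  have hone : χ.comp (baseChangeEquiv K G).symm.toMonoidHom = 1 := by
    refine character_eq_one (s := s.image (map (algebraMap k K))) (adjoin_baseChange hgen)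
      (fun i => (hp i).map _) hd ?_ ?_ _ ?_
    · rw [Finset.card_image_of_injective _ (map_injective _ (algebraMap k K).injective), hcard]
    · rw [Finset.coe_image]
      exact relIdeal_baseChange hs
    · intro g hg
      obtain ⟨g, rfl⟩ := (baseChangeEquiv K G).surjective g
      have hg' := hχ g fun h => hg (by simpa using h)
      exact (Nat.add_le_add_right (finrank_fixK_map_le (K := K) _) 3).trans hg'
  ext1 g
  simpa using DFunLike.congr_fun hone (baseChangeEquiv K G g)

end BaseChange

/-- if `G` is good and contains no reflection, then (i) `G` is generated
by double reflections, (ii) the image in `W ⊆ GL(V)` of a reflection of `Wt` is a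
reflection of `V` of the same order, (iii) `G ⊆ SL(Vt)`. -/
theorem statement7 [CharZero k] {n m : ℕ}
    (Wt G : Subgroup (Matrix.GeneralLinearGroup (Fin n) k))
    (p : Fin m → MvPolynomial (Fin n) k) (d : Fin m → ℕ)
    (c : ↥Wt → Fin m → Fin m → k)
    (hsetup : QuotSetup Wt G p d c)
    (hgood : IsGoodQuot Wt p c)
    (hnorefl : ∀ g ∈ G, ¬ IsReflection ((g : Matrix (Fin n) (Fin n) k))) :
    (Subgroup.closure
        {g | g ∈ G ∧ IsDoubleReflection ((g : Matrix (Fin n) (Fin n) k))} = G)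
    ∧ (∀ s : ↥Wt, IsReflection (matOf s) →
        IsReflection (qMat c s) ∧ orderOf (qMat c s) = orderOf (matOf s))
    ∧ (∀ g ∈ G, Matrix.det ((g : Matrix.GeneralLinearGroup (Fin n) k) :
        Matrix (Fin n) (Fin n) k) = 1) := by
  refine ⟨?_, fun s hs => hsetup.isReflection_qMat hgood.2 hnorefl hs,
    fun g hg => hsetup.det_eq_one hgood.2 hnorefl hg⟩
  by_contra hne
  have : Finite G := hsetup.finiteG
  have : CharZero (AlgebraicClosure k) :=
    charZero_of_injective_algebraMap (algebraMap k _).injective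
  obtain ⟨χ, hχ1, hχ⟩ := hsetup.exists_character hnorefl (AlgebraicClosure k) hne
  exact hχ1 (character_eq_one_of_extension hsetup.gen hsetup.homog hsetup.dpos hgood.1 χ hχ)

end ReflQuot
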